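/- arXiv:2605.00811 — 6 statements merged into one kernel-verified Lean document; each statement's English description precedes it below -/
import Mathlib

section
/- With I_q(a_0; a_1,…,a_k; a_{k+1}) := Σ_{a_0 ⊴ t_1 ⊴ ⋯ ⊴ t_k ⊴ a_{k+1}} ∏_{j=1}^k t_j/(t_j − a_j), let 0 < h < k and a_h ≠ a_{h+1}. Then I_q(a_0; a_1,…,a_k; a_{k+1}) − I_q(a_0; a_1,…,a_h, a_{h+1}q,…,a_k q; a_{k+1}q) = (a_h · I_q(a_0; a_1,…,\widehat{a_{h+1}},…,a_k; a_{k+1}) − a_{h+1} · I_q(a_0; a_1,…,\widehat{a_h},…,a_k; a_{k+1}))/(a_h − a_{h+1}), where the hat denotes omission of that entry. -/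
/-- The iterated `q`-integral `I_q(a_0; a_1, …, a_k; a_{k+1})` with `a_0 = x` and
`a_{k+1} = x * q^{-N}`: the sum over chains `x ⊴ t_1 ⊴ ⋯ ⊴ t_k ⊴ x q^{-N}`
(i.e. `t_j = x q^{-n_j}`, `0 ≤ n_1 ≤ ⋯ ≤ n_k ≤ N`) of `∏_j t_j/(t_j - a_j)`. -/
noncomputable def IqS {K : Type*} [Field K] (q x : K) (N : ℕ) (a : List K) : K :=
  ∑ n ∈ Finset.univ.filter (fun n : Fin a.length → Fin (N + 1) =>
      ∀ i j : Fin a.length, i ≤ j → n i ≤ n j),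
    ∏ j : Fin a.length,
      x * q ^ (-((n j : ℕ) : ℤ)) / (x * q ^ (-((n j : ℕ) : ℤ)) - a.get j)

/-- The sum of `∏ j, f (n j) (a j)` over chains `l ≤ n₁ ≤ ⋯ ≤ n_k ≤ N`, defined recursively. -/
def chainSum {K : Type*} [Field K] (f : ℕ → K → K) (N : ℕ) : ℕ → List K → K
  | _, [] => 1
  | l, a :: as => ∑ n ∈ Finset.Icc l N, f n a * chainSum f N n as

section chainSum

variable {K : Type*} [Field K] (f : ℕ → K → K) (N : ℕ)

theorem sum_monotone_eq_chainSum (as : List K) (l : ℕ) :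
    (∑ n : Fin as.length → Fin (N + 1),
      if (∀ i j, i ≤ j → n i ≤ n j) ∧ ∀ j, l ≤ (n j : ℕ) then
        ∏ j, f (n j) (as.get j) else 0) = chainSum f N l as := by
  induction as generalizing l with
  | nil => simp [chainSum]
  | cons a as ih =>
    have hIcc : Finset.Icc l N = (Finset.range (N + 1)).filter (l ≤ ·) := by
      ext n; simp only [Finset.mem_Icc, Finset.mem_filter, Finset.mem_range]; omega
    rw [chainSum, hIcc, Finset.sum_filter, Finset.sum_range]
    refine ((Fin.consEquiv (n := as.length) (fun _ => Fin (N + 1))).sum_comp _).symm.trans ?_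
    rw [Fintype.sum_prod_type]
    refine Finset.sum_congr rfl fun m _ => ?_
    rw [← ih, Finset.mul_sum]
    have key : ∀ n : Fin as.length → Fin (N + 1),
        ((∀ i j : Fin (as.length + 1), i ≤ j →
            (Fin.cons m n : Fin (as.length + 1) → Fin (N + 1)) i ≤
              (Fin.cons m n : Fin (as.length + 1) → Fin (N + 1)) j) ∧
          ∀ j, l ≤ ((Fin.cons m n : Fin (as.length + 1) → Fin (N + 1)) j : ℕ)) ↔
        l ≤ (m : ℕ) ∧ (∀ i j, i ≤ j → n i ≤ n j) ∧ ∀ j, (m : ℕ) ≤ (n j : ℕ) := by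
      intro n
      constructor
      · rintro ⟨h1, h2⟩
        exact ⟨by simpa using h2 0,
          fun i j hij => by simpa using h1 i.succ j.succ (Fin.succ_le_succ_iff.2 hij),
          fun j => by simpa using h1 0 j.succ (Fin.zero_le _)⟩
      · rintro ⟨h1, h2, h3⟩
        refine ⟨fun i j => ?_, Fin.cases (by simpa using h1) fun j => by simpa using h1.trans (h3 j)⟩
        cases i using Fin.cases with
        | zero =>
          cases j using Fin.cases with
          | zero => exact fun _ => le_rfl
          | succ j => simpa using h3 j
        | succ i =>
          cases j using Fin.cases with
          | zero => exact fun h => absurd h (by simp)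
          | succ j => simpa using h2 i j
    split_ifs with hl
    · refine Finset.sum_congr rfl fun n _ => ?_
      rw [mul_ite, mul_zero]
      refine if_congr ((key n).trans (and_iff_right hl)) ?_ rfl
      exact Fin.prod_univ_succ _
    · exact Finset.sum_eq_zero fun n _ => if_neg fun h => hl ((key n).1 h).1

theorem chainSum_cons_of_lt {l : ℕ} (h : N < l) (a : K) (as : List K) :
    chainSum f N l (a :: as) = 0 := by
  rw [chainSum, Finset.Icc_eq_empty_of_lt h, Finset.sum_empty]

theorem chainSum_cons_eq_add {l : ℕ} (h : l ≤ N) (a : K) (as : List K) :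
    chainSum f N l (a :: as) = f l a * chainSum f N l as + chainSum f N (l + 1) (a :: as) := by
  rw [chainSum, chainSum, ← Finset.insert_Icc_add_one_left_eq_Icc h, Finset.sum_insert (by simp)]

variable {f}

theorem chainSum_map_mul {q : K} (hf : ∀ n a, f n (a * q) = f (n + 1) a) (as : List K) (l : ℕ) :
    chainSum f N l (as.map (· * q)) = chainSum f (N + 1) (l + 1) as := by
  induction as generalizing l with
  | nil => rfl
  | cons a as ih =>
    rw [List.map_cons, chainSum, chainSum, ← Finset.map_add_right_Icc, Finset.sum_map]
    exact Finset.sum_congr rfl fun n _ => by rw [hf, ih]; rfl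

/-- If the tail is nonempty, the range of the outermost variable can be enlarged by one. -/
theorem chainSum_cons_eq_sum_Icc_succ (c : K) {as : List K} (has : as ≠ []) (l : ℕ) :
    chainSum f N l (c :: as) = ∑ n ∈ Finset.Icc l (N + 1), f n c * chainSum f N n as := by
  rw [chainSum]
  refine Finset.sum_subset (Finset.Icc_subset_Icc_right N.le_succ) fun n hn hn' => ?_
  obtain ⟨a, as, rfl⟩ := List.exists_cons_of_ne_nil has
  simp only [Finset.mem_Icc] at hn hn'
  rw [chainSum_cons_of_lt f N (by omega), mul_zero]

theorem chainSum_sub_chainSum_map_mul {q a b : K} (post : List K)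
    (hf : ∀ n a, f n (a * q) = f (n + 1) a)
    (hab : ∀ n ≤ N + 1, f n a * f n b = (a * f n a - b * f n b) / (a - b))
    (pre : List K) (l : ℕ) :
    chainSum f (N + 1) l (pre ++ a :: b :: post)
        - chainSum f N l (pre ++ a :: (b :: post).map (· * q))
      = (a * chainSum f (N + 1) l (pre ++ a :: post)
        - b * chainSum f (N + 1) l (pre ++ b :: post)) / (a - b) := by
  induction pre generalizing l with
  | nil =>
    simp only [List.nil_append]
    rw [chainSum_cons_eq_sum_Icc_succ N a (by simp)]
    simp only [chainSum_map_mul N hf]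
    rw [chainSum, chainSum, chainSum, ← Finset.sum_sub_distrib, Finset.mul_sum, Finset.mul_sum,
      ← Finset.sum_sub_distrib, Finset.sum_div]
    refine Finset.sum_congr rfl fun n hn => ?_
    have hn' := (Finset.mem_Icc.1 hn).2
    rw [chainSum_cons_eq_add f _ hn']
    linear_combination chainSum f (N + 1) n post * hab n hn'
  | cons c pre ih =>
    simp only [List.cons_append]
    rw [chainSum_cons_eq_sum_Icc_succ N c (by simp), chainSum, chainSum, chainSum,
      ← Finset.sum_sub_distrib, Finset.mul_sum, Finset.mul_sum,
      ← Finset.sum_sub_distrib, Finset.sum_div]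
    refine Finset.sum_congr rfl fun n _ => ?_
    linear_combination f n c * ih n

end chainSum

theorem IqS_eq_chainSum {K : Type*} [Field K] (q x : K) (N : ℕ) (as : List K) :
    IqS q x N as
      = chainSum (fun n a => x * q ^ (-(n : ℤ)) / (x * q ^ (-(n : ℤ)) - a)) N 0 as := by
  rw [← sum_monotone_eq_chainSum, IqS, Finset.sum_filter]
  simp

/-- **The `q`-difference formula** (Lemma 2.4 of the paper, case `0 < h < k`).
Here the letters are `pre ++ [ah, ah1] ++ post` (so `h = pre.length + 1`), the endpoints
are `a_0 = x` and `a_{k+1} = x q^{-(N+1)}`; the `q`-shifted integral has letters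
`pre ++ [ah] ++ (ah1::post) * q` and endpoint `a_{k+1} q = x q^{-N}`.  Assuming
`a_h ≠ a_{h+1}` and that all letters avoid the interval, the difference equals
`(a_h I_q(…,â_{h+1},…) - a_{h+1} I_q(…,â_h,…))/(a_h - a_{h+1})`. -/
theorem iq_difference_formula {K : Type*} [Field K] (q x : K) (N : ℕ)
    (pre post : List K) (ah ah1 : K)
    (hq0 : q ≠ 0) (hq : ∀ n : ℕ, 1 ≤ n → q ^ n ≠ 1) (hx : x ≠ 0)
    (hne : ah ≠ ah1)
    (havoid : ∀ a ∈ pre ++ ah :: ah1 :: post, ∀ n : ℕ, n ≤ N + 1 →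
      x * q ^ (-(n : ℤ)) ≠ a) :
    IqS q x (N + 1) (pre ++ ah :: ah1 :: post)
      - IqS q x N (pre ++ ah :: (ah1 :: post).map (· * q))
    = (ah * IqS q x (N + 1) (pre ++ ah :: post)
        - ah1 * IqS q x (N + 1) (pre ++ ah1 :: post)) / (ah - ah1) := by
  simp only [IqS_eq_chainSum]
  refine chainSum_sub_chainSum_map_mul N post (fun n a => ?_) (fun n hn => ?_) pre 0
  · have h : x * q ^ (-(n : ℤ)) = x * q ^ (-((n + 1 : ℕ) : ℤ)) * q := by
      rw [mul_assoc, ← zpow_add_one₀ hq0]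
      congr 2
      push_cast
      ring
    simp only [h]
    rw [← sub_mul, mul_div_mul_right _ _ hq0]
  · have ha := sub_ne_zero.2 (havoid ah (by simp) n hn)
    have hb := sub_ne_zero.2 (havoid ah1 (by simp) n hn)
    have hab := sub_ne_zero.2 hne
    generalize x * q ^ (-(n : ℤ)) = t at ha hb ⊢
    field_simp
    ring
end

section
/- For positive integers k_1,…,k_d, the multiple q-polylogarithm Li_{q;k_1,…,k_d}(z_1,…,z_d) := Σ_{0<n_1<⋯<n_d} z_1^{n_1}⋯z_d^{n_d}/((1−q^{n_1})^{k_1}⋯(1−q^{n_d})^{k_d}), viewed as a formal power series, satisfies Li_{q;k_1,…,k_d}(z_1,…,z_d) = (−1)^d · I_q(0; a_1, 0^{k_1−1}, …, a_d, 0^{k_d−1}; 1), where a_i = 1/(z_i z_{i+1} ⋯ z_d), and I_q(0; b_1,…,b_k; 1) := Σ_{t_1 ⊴ ⋯ ⊴ t_k ⊴ 1} ∏_j t_j/(t_j − b_j), the sum over chains of elements of {q^n : n ≥ 0} with t ⊴ t' meaning t'/t ∈ q^{−ℤ_{≥0}}. -/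
/- The ambient ring `ℚ[[q, x_1, …, x_d]]`, with variable `0` playing the role of `q`
and variable `i.succ` playing the role of `x_i = z_i ⋯ z_d`.  We endow it with the
product topology (coefficientwise convergence), so that the `q`-adically convergent
sums of the paper become honest `tsum`s (each coefficient receives only finitely many
nonzero contributions). -/

variable {d : ℕ}

noncomputable instance (σ : Type*) : TopologicalSpace (MvPowerSeries σ ℚ) :=
  inferInstanceAs (TopologicalSpace ((σ →₀ ℕ) → ℚ))

instance (σ : Type*) : T2Space (MvPowerSeries σ ℚ) :=
  inferInstanceAs (T2Space ((σ →₀ ℕ) → ℚ))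

/-- `q` as an element of `ℚ[[q,x_1,…,x_d]]`. -/
noncomputable def qv (d : ℕ) : MvPowerSeries (Fin (d + 1)) ℚ := MvPowerSeries.X 0

/-- `x_i` as an element of `ℚ[[q,x_1,…,x_d]]`. -/
noncomputable def xv {d : ℕ} (i : Fin d) : MvPowerSeries (Fin (d + 1)) ℚ :=
  MvPowerSeries.X i.succ

/-- The multiple `q`-polylogarithm
`Li_{q;k_1,…,k_d}(z_1,…,z_d) = Σ_{0<n_1<⋯<n_d} x_1^{n_1} x_2^{n_2−n_1} ⋯ x_d^{n_d−n_{d−1}}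
  / ((1−q^{n_1})^{k_1} ⋯ (1−q^{n_d})^{k_d})` as a formal power series in
`ℚ[[q,x_1,…,x_d]]` (with `x_j = z_j ⋯ z_d`). -/
noncomputable def qLi (k : Fin d → ℕ) : MvPowerSeries (Fin (d + 1)) ℚ :=
  ∑' n : {n : Fin d → ℕ // StrictMono n ∧ ∀ i, 0 < n i},
    ∏ i : Fin d,
      (xv i) ^ (n.1 i - (if (i : ℕ) = 0 then 0 else n.1 ⟨(i : ℕ) - 1, lt_of_le_of_lt (Nat.sub_le _ _) i.isLt⟩))
        * Ring.inverse ((1 - (qv d) ^ (n.1 i)) ^ (k i))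

/-- The word `a_1, 0^{k_1−1}, a_2, 0^{k_2−1}, …, a_d, 0^{k_d−1}`: `some i` stands for
the letter `a_i = 1/(z_i ⋯ z_d) = 1/x_i`, and `none` for the letter `0`. -/
def qword (k : Fin d → ℕ) : List (Option (Fin d)) :=
  (List.ofFn (fun i : Fin d => some i :: List.replicate (k i - 1) none)).flatten

/-- The factor `t/(t − a)` of the iterated `q`-integral at a chain point `t = q^m`:
for the letter `0` it is `1`, and for the letter `a_i = 1/x_i` it is
`t/(t − 1/x_i) = −(q^m x_i)(1 − q^m x_i)^{-1}`. -/
noncomputable def qfactor (m : ℕ) : Option (Fin d) → MvPowerSeries (Fin (d + 1)) ℚ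
  | none => 1
  | some i => -((qv d) ^ m * xv i) * Ring.inverse (1 - (qv d) ^ m * xv i)

/-- The iterated `q`-integral `I_q(0; a_1, 0^{k_1−1}, …, a_d, 0^{k_d−1}; 1)`: the sum
over chains `t_1 ⊴ ⋯ ⊴ t_k ⊴ 1` in `{q^m : m ≥ 0}` (i.e. `t_j = q^{m_j}` with
`m_1 ≥ m_2 ≥ ⋯ ≥ m_k ≥ 0`) of `∏_j t_j/(t_j − a_j)`. -/
noncomputable def qIint (k : Fin d → ℕ) : MvPowerSeries (Fin (d + 1)) ℚ :=
  ∑' m : {m : Fin (qword k).length → ℕ // Antitone m},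
    ∏ j : Fin (qword k).length, qfactor (m.1 j) ((qword k).get j)

/-- A family of power series is summable if only finitely many members have order below any
given bound. -/
theorem MvPowerSeries.summable_of_finite_order_lt {σ ι : Type*} {f : ι → MvPowerSeries σ ℚ}
    (h : ∀ N : ℕ, {i | ¬ (N : ℕ∞) ≤ (f i).order}.Finite) : Summable f := by
  refine Pi.summable.mpr fun e => ?_
  refine summable_of_hasFiniteSupport ((h (e.degree + 1)).subset fun i hi hle => hi ?_)
  exact coeff_of_lt_order (lt_of_lt_of_le (by exact_mod_cast e.degree.lt_succ_self) hle)

instance MvPowerSeries.isTopologicalRing_rat (σ : Type*) :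
    IsTopologicalRing (MvPowerSeries σ ℚ) :=
  MvPowerSeries.WithPiTopology.instIsTopologicalRing σ ℚ

instance MvPowerSeries.regularSpace_rat (σ : Type*) : RegularSpace (MvPowerSeries σ ℚ) :=
  inferInstanceAs (RegularSpace ((σ →₀ ℕ) → ℚ))

theorem MvPowerSeries.inverse_one_sub_mul {σ : Type*} {y : MvPowerSeries σ ℚ}
    (hy : y.constantCoeff = 0) : (1 - y) * Ring.inverse (1 - y) = 1 :=
  Ring.mul_inverse_cancel _ (by simp [MvPowerSeries.isUnit_iff_constantCoeff, hy])

theorem MvPowerSeries.hasSum_pow {σ : Type*} {y : MvPowerSeries σ ℚ}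
    (hy : y.constantCoeff = 0) : HasSum (fun n : ℕ => y ^ n) (Ring.inverse (1 - y)) := by
  have hs : Summable (fun n : ℕ => y ^ n) := by
    refine MvPowerSeries.summable_of_finite_order_lt fun N => ?_
    refine (Set.finite_lt_nat N).subset fun n hn => ?_
    by_contra! hlt
    refine hn (le_trans ?_ (le_order_pow_of_constantCoeff_eq_zero n hy))
    exact_mod_cast not_lt.mp hlt
  have h1 := hs.one_sub_mul_tsum_pow
  have h2 := MvPowerSeries.inverse_one_sub_mul hy
  have h3 : ∑' n : ℕ, y ^ n = Ring.inverse (1 - y) := by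
    linear_combination (Ring.inverse (1 - y)) * h1 - (∑' n : ℕ, y ^ n) * h2
  exact h3 ▸ hs.hasSum

theorem MvPowerSeries.sum_le_order_prod_pow {σ ι : Type*} [Fintype ι]
    {y : ι → MvPowerSeries σ ℚ} (hy : ∀ i, (y i).constantCoeff = 0) (s : ι → ℕ) :
    ((∑ i, s i : ℕ) : ℕ∞) ≤ (∏ i, y i ^ s i).order := by
  refine le_trans ?_ (le_order_prod _ _)
  push_cast
  exact Finset.sum_le_sum fun i _ => le_order_pow_of_constantCoeff_eq_zero _ (hy i)

theorem finite_sum_lt (ι : Type*) [Fintype ι] (N : ℕ) :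
    {s : ι → ℕ | ∑ i, s i < N}.Finite :=
  (Set.Finite.pi' fun _ : ι => Set.finite_Iic N).subset fun _ hs i =>
    (Finset.single_le_sum (fun _ _ => Nat.zero_le _) (Finset.mem_univ i)).trans hs.le

theorem MvPowerSeries.hasSum_prod_pow {σ : Type*} {n : ℕ} {y : Fin n → MvPowerSeries σ ℚ}
    (hy : ∀ i, (y i).constantCoeff = 0) :
    HasSum (fun s : Fin n → ℕ => ∏ i, y i ^ s i) (∏ i, Ring.inverse (1 - y i)) := by
  have hs {m : ℕ} {z : Fin m → MvPowerSeries σ ℚ} (hz : ∀ i, (z i).constantCoeff = 0) :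
      Summable (fun s : Fin m → ℕ => ∏ i, z i ^ s i) := by
    refine summable_of_finite_order_lt fun N => (finite_sum_lt (Fin m) N).subset fun s hs => ?_
    by_contra hlt
    refine hs (le_trans ?_ (sum_le_order_prod_pow hz s))
    exact_mod_cast not_lt.mp hlt
  induction n with
  | zero => simp
  | succ n ih =>
    have hsum := (Fin.consEquiv fun _ => ℕ).summable_iff.mpr (hs hy)
    rw [← (Fin.consEquiv fun _ => ℕ).hasSum_iff, Fin.prod_univ_succ]
    refine ((hasSum_pow (hy 0)).mul (ih fun i => hy i.succ) ?_).congr_fun ?_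
    · simpa [Function.comp_def, Fin.prod_univ_succ, Fin.consEquiv] using hsum
    · intro s
      simp [Fin.prod_univ_succ, Fin.consEquiv]

theorem MvPowerSeries.summable_prod_pow_mul_prod_pow {σ ι κ : Type*} [Fintype ι] [Fintype κ]
    {y : ι → MvPowerSeries σ ℚ} {z : (ι → ℕ) → κ → MvPowerSeries σ ℚ}
    (hy : ∀ i, (y i).constantCoeff = 0) (hz : ∀ r j, (z r j).constantCoeff = 0) :
    Summable fun x : (ι → ℕ) × (κ → ℕ) =>
      (∏ i, y i ^ (x.1 i + 1)) * ∏ j, z x.1 j ^ x.2 j := by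
  refine summable_of_finite_order_lt fun M =>
    ((finite_sum_lt ι M).prod (finite_sum_lt κ M)).subset fun x hxM => ?_
  have h1 := sum_le_order_prod_pow hy fun i => x.1 i + 1
  have h2 := sum_le_order_prod_pow (hz x.1) x.2
  have h3 : ∑ i, x.1 i ≤ ∑ i, (x.1 i + 1) := Finset.sum_le_sum fun i _ => Nat.le_succ _
  have hle : ((∑ i, x.1 i + ∑ j, x.2 j : ℕ) : ℕ∞) ≤
      ((∏ i, y i ^ (x.1 i + 1)) * ∏ j, z x.1 j ^ x.2 j).order := by
    rw [Nat.cast_add]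
    exact (add_le_add ((Nat.cast_le.mpr h3).trans h1) h2).trans le_order_mul
  have hlt : ∑ i, x.1 i + ∑ j, x.2 j < M := by
    by_contra h
    exact hxM ((Nat.cast_le.mpr (not_lt.mp h)).trans hle)
  exact ⟨(Nat.le_add_right _ _).trans_lt hlt, (Nat.le_add_left _ _).trans_lt hlt⟩

/-- The partial sums `v 0 + ⋯ + v i`. -/
def prefixSum {n : ℕ} (v : Fin n → ℕ) (i : Fin n) : ℕ := ∑ j, if j ≤ i then v j else 0

theorem prefixSum_eq_prev_add {n : ℕ} (v : Fin n → ℕ) (i : Fin n) :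
    prefixSum v i = (if (i : ℕ) = 0 then 0 else
      prefixSum v ⟨(i : ℕ) - 1, lt_of_le_of_lt (Nat.sub_le _ _) i.isLt⟩) + v i := by
  have hi : v i = ∑ j, if j = i then v j else 0 := by simp
  rw [hi]
  unfold prefixSum
  split_ifs with h0
  · rw [zero_add]
    refine Finset.sum_congr rfl fun j _ => if_congr ?_ rfl rfl
    simp only [Fin.le_def, Fin.ext_iff]
    omega
  · rw [← Finset.sum_add_distrib]
    refine Finset.sum_congr rfl fun j _ => ?_
    simp only [Fin.le_def, Fin.ext_iff]
    split_ifs <;> omega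

theorem eq_prefixSum {n : ℕ} {v m : Fin n → ℕ}
    (h : ∀ i, m i = (if (i : ℕ) = 0 then 0 else
      m ⟨(i : ℕ) - 1, lt_of_le_of_lt (Nat.sub_le _ _) i.isLt⟩) + v i) : m = prefixSum v := by
  have key (a : ℕ) (ha : a < n) : m ⟨a, ha⟩ = prefixSum v ⟨a, ha⟩ := by
    induction a with
    | zero => rw [h, prefixSum_eq_prev_add]; simp
    | succ a ih =>
      rw [h, prefixSum_eq_prev_add]
      simpa using ih (Nat.lt_of_succ_lt ha)
  exact funext fun i => key i i.isLt

theorem prefixSum_injective (n : ℕ) : Function.Injective (prefixSum (n := n)) := by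
  intro v w h
  funext i
  have hv := prefixSum_eq_prev_add v i
  rw [h, prefixSum_eq_prev_add w i] at hv
  omega

theorem prefixSum_mono {n : ℕ} (v : Fin n → ℕ) : Monotone (prefixSum v) := by
  intro a b hab
  refine Finset.sum_le_sum fun j _ => ?_
  split_ifs with h1 h2
  · exact le_rfl
  · exact absurd (h1.trans hab) h2
  · exact Nat.zero_le _
  · exact le_rfl

theorem le_prefixSum {n : ℕ} (v : Fin n → ℕ) (i : Fin n) : v i ≤ prefixSum v i := by
  rw [prefixSum_eq_prev_add]
  exact Nat.le_add_left _ _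

theorem prefixSum_succ {n : ℕ} (v : Fin (n + 1) → ℕ) (i : Fin n) :
    prefixSum v i.succ = v 0 + prefixSum (fun j => v j.succ) i := by
  simp [prefixSum, Fin.sum_univ_succ]

theorem prefixSum_zero {n : ℕ} (v : Fin (n + 1) → ℕ) : prefixSum v 0 = v 0 := by
  simp [prefixSum]

theorem strictMono_prefixSum_succ {n : ℕ} (r : Fin n → ℕ) :
    StrictMono (prefixSum fun i => r i + 1) := by
  intro a b hab
  rw [prefixSum_eq_prev_add _ b, if_neg (by have := Fin.lt_def.mp hab; omega)]
  have := prefixSum_mono (fun i => r i + 1) (a := a)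
    (b := ⟨(b : ℕ) - 1, lt_of_le_of_lt (Nat.sub_le _ _) b.isLt⟩)
    (Fin.le_def.mpr (by have := Fin.lt_def.mp hab; simp only; omega))
  omega

/-- Increasing sequences of positive integers correspond to their differences minus one. -/
noncomputable def strictMonoEquiv (n : ℕ) :
    (Fin n → ℕ) ≃ {m : Fin n → ℕ // StrictMono m ∧ ∀ i, 0 < m i} :=
  Equiv.ofBijective
    (fun r => ⟨prefixSum fun i => r i + 1, strictMono_prefixSum_succ r,
      fun i => (Nat.succ_pos _).trans_le (le_prefixSum (fun i => r i + 1) i)⟩) <| by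
    constructor
    · intro r s h
      funext i
      have := congrFun (prefixSum_injective n (Subtype.ext_iff.mp h)) i
      simpa using this
    · rintro ⟨m, hm, hpos⟩
      refine ⟨fun i => m i - (if (i : ℕ) = 0 then 0 else
        m ⟨(i : ℕ) - 1, lt_of_le_of_lt (Nat.sub_le _ _) i.isLt⟩) - 1, Subtype.ext ?_⟩
      refine (eq_prefixSum fun i => ?_).symm
      dsimp only
      split_ifs with h0
      · have := hpos i
        omega
      · have := hm (a := ⟨(i : ℕ) - 1, lt_of_le_of_lt (Nat.sub_le _ _) i.isLt⟩) (b := i)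
          (Fin.lt_def.mpr (by simp only; omega))
        omega

/-- Weakly decreasing sequences of natural numbers correspond to their reversed differences. -/
noncomputable def antitoneEquiv (n : ℕ) : (Fin n → ℕ) ≃ {m : Fin n → ℕ // Antitone m} :=
  Equiv.ofBijective
    (fun u => ⟨fun j => prefixSum u j.rev,
      fun _ _ h => prefixSum_mono u (Fin.rev_le_rev.mpr h)⟩) <| by
    constructor
    · intro u v h
      refine prefixSum_injective n (funext fun j => ?_)
      simpa using congrFun (Subtype.ext_iff.mp h) j.rev
    · rintro ⟨m, hm⟩
      refine ⟨fun i => m i.rev - (if (i : ℕ) = 0 then 0 else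
        m (Fin.rev ⟨(i : ℕ) - 1, lt_of_le_of_lt (Nat.sub_le _ _) i.isLt⟩)), Subtype.ext ?_⟩
      have h := eq_prefixSum (m := fun i => m i.rev) (v := fun i => m i.rev -
        (if (i : ℕ) = 0 then 0 else
          m (Fin.rev ⟨(i : ℕ) - 1, lt_of_le_of_lt (Nat.sub_le _ _) i.isLt⟩))) fun i => by
          have h1 : m (Fin.rev ⟨(i : ℕ) - 1, lt_of_le_of_lt (Nat.sub_le _ _) i.isLt⟩) ≤ m i.rev :=
            hm (Fin.rev_le_rev.mpr (Fin.le_def.mpr (by simp)))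
          split_ifs <;> omega
      funext j
      simpa using (congrFun h j.rev).symm

/-- Summation by parts: pairing weights with a reversed sequence of partial sums. -/
theorem sum_mul_prefixSum_rev {n : ℕ} (w u : Fin n → ℕ) :
    ∑ j, w j * prefixSum u j.rev = ∑ j, prefixSum w j.rev * u j := by
  simp only [prefixSum, Finset.mul_sum, Finset.sum_mul]
  rw [Finset.sum_comm]
  refine Finset.sum_congr rfl fun i _ => Finset.sum_congr rfl fun j _ => ?_
  simp [Fin.le_rev_iff (i := i)]

/-- The weight of a letter: `0` for the letter `0`, and `v i` for the letter `a_i`. -/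
def letterWeight {ι : Type*} (v : ι → ℕ) (a : Option ι) : ℕ := a.elim 0 v

theorem exists_position_qword (k : Fin d → ℕ) :
    ∃ p : Fin d → Fin (qword k).length, (∀ i, (qword k).get (p i) = some i) ∧
      ∀ j i, (qword k).get j = some i → p i = j := by
  have hmem (i : Fin d) : some i ∈ qword k := by
    simp only [qword, List.mem_flatten, List.mem_ofFn]
    exact ⟨_, ⟨i, rfl⟩, List.mem_cons_self⟩
  have hpw : (qword k).Pairwise fun a b => ∀ i, a = some i → b ≠ some i := by
    rw [qword, List.pairwise_flatten, List.pairwise_ofFn]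
    refine ⟨?_, fun i j hij a ha b hb l hl hl' => ?_⟩
    · simp only [List.mem_ofFn]
      rintro _ ⟨i, rfl⟩
      refine List.pairwise_cons.mpr ⟨fun b hb l _ => ?_, ?_⟩
      · simp [List.eq_of_mem_replicate hb]
      · simp [List.pairwise_replicate]
    · subst hl hl'
      simp only [List.mem_cons, Option.some.injEq, List.mem_replicate, reduceCtorEq, and_false,
        or_false] at ha hb
      exact hij.ne (ha.symm.trans hb)
  choose p hp using fun i => List.get_of_mem (hmem i)
  refine ⟨p, hp, fun j i hj => ?_⟩
  rw [List.pairwise_iff_get] at hpw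
  rcases lt_trichotomy (p i) j with h | h | h
  · exact absurd hj (hpw _ _ h i (hp i))
  · exact h
  · exact absurd (hp i) (hpw _ _ h i hj)

theorem prod_qword_eq_prod {M : Type*} [CommMonoid M] {k : Fin d → ℕ}
    {p : Fin d → Fin (qword k).length} (hp : ∀ i, (qword k).get (p i) = some i)
    (hp' : ∀ j i, (qword k).get j = some i → p i = j)
    (f : Fin (qword k).length → Option (Fin d) → M) (hf : ∀ j, f j none = 1) :
    ∏ j, f j ((qword k).get j) = ∏ i, f (p i) (some i) := by
  have hinj : Function.Injective p := fun a b h =>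
    Option.some_injective _ ((hp a).symm.trans (h ▸ hp b))
  symm
  refine Finset.prod_of_injOn p hinj.injOn (by simp) (fun j _ hj => ?_) (fun i _ => by rw [hp])
  cases h : (qword k).get j with
  | none => exact hf j
  | some i => exact absurd ⟨i, by simp, hp' j i h⟩ hj

/-- The product of `g` over the running totals of a list of weights, started at `c`. -/
def runningProd {M : Type*} [CommMonoid M] (g : ℕ → M) : ℕ → List ℕ → M
  | _, [] => 1
  | c, a :: l => g (c + a) * runningProd g (c + a) l

theorem runningProd_replicate_append {M : Type*} [CommMonoid M] (g : ℕ → M) (c t : ℕ)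
    (l : List ℕ) :
    runningProd g c (List.replicate t 0 ++ l) = g c ^ t * runningProd g c l := by
  induction t with
  | zero => simp
  | succ t ih => simp [List.replicate_succ, runningProd, ih, pow_succ', mul_assoc]

theorem runningProd_flatten {M : Type*} [CommMonoid M] (g : ℕ → M) {n : ℕ} (v k : Fin n → ℕ)
    (hk : ∀ i, 1 ≤ k i) (c : ℕ) :
    runningProd g c (List.ofFn fun i => v i :: List.replicate (k i - 1) 0).flatten =
      ∏ i, g (c + prefixSum v i) ^ k i := by
  induction n generalizing c with
  | zero => simp [runningProd]
  | succ n ih =>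
    rw [List.ofFn_succ, List.flatten_cons, List.cons_append, runningProd,
      runningProd_replicate_append, ih _ _ (fun i => hk i.succ), Fin.prod_univ_succ,
      prefixSum_zero, ← mul_assoc, ← pow_succ', Nat.sub_add_cancel (hk 0)]
    simp [prefixSum_succ, add_assoc]

theorem prod_prefixSum_eq_runningProd {M : Type*} [CommMonoid M] (g : ℕ → M) {α : Type*}
    (w : α → ℕ) (l : List α) (c : ℕ) :
    ∏ j : Fin l.length, g (c + prefixSum (fun j => w (l.get j)) j) =
      runningProd g c (l.map w) := by
  induction l generalizing c with
  | nil => simp [runningProd]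
  | cons a l ih =>
    rw [List.map_cons, runningProd, ← ih]
    simp only [List.length_cons]
    rw [Fin.prod_univ_succ]
    simp [prefixSum_zero, prefixSum_succ, add_assoc]

theorem prod_prefixSum_qword {M : Type*} [CommMonoid M] (g : ℕ → M) (k : Fin d → ℕ)
    (hk : ∀ i, 1 ≤ k i) (v : Fin d → ℕ) :
    ∏ j, g (prefixSum (fun j => letterWeight v ((qword k).get j)) j) =
      ∏ i, g (prefixSum v i) ^ k i := by
  have h := prod_prefixSum_eq_runningProd g (letterWeight v) (qword k) 0
  have hw : (qword k).map (letterWeight v) =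
      (List.ofFn fun i => v i :: List.replicate (k i - 1) 0).flatten := by
    simp [qword, List.map_flatten, List.map_ofFn, Function.comp_def, letterWeight]
  rw [hw, runningProd_flatten g v k hk] at h
  simpa using h

theorem prefixSum_qword_pos (k : Fin d → ℕ) {v : Fin d → ℕ} (hv : ∀ i, 0 < v i)
    (j : Fin (qword k).length) :
    0 < prefixSum (fun j => letterWeight v ((qword k).get j)) j := by
  have hlen : 0 < (qword k).length := j.pos
  have hle : (⟨0, hlen⟩ : Fin (qword k).length) ≤ j := Fin.le_def.mpr (Nat.zero_le _)
  refine lt_of_lt_of_le ?_ ((le_prefixSum _ _).trans (prefixSum_mono _ hle))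
  cases d with
  | zero => simp [qword] at hlen
  | succ d => simpa [qword, List.ofFn_succ, letterWeight] using hv 0

theorem constantCoeff_qv (d : ℕ) : (qv d).constantCoeff = 0 :=
  MvPowerSeries.constantCoeff_X _

theorem constantCoeff_xv (i : Fin d) : (xv i).constantCoeff = 0 :=
  MvPowerSeries.constantCoeff_X _

/-- The sum of the exponents `r i + 1` over the letters `a_i` at positions up to `j`. -/
def wordExponent (k r : Fin d → ℕ) : Fin (qword k).length → ℕ :=
  prefixSum fun j => letterWeight (fun i => r i + 1) ((qword k).get j)

theorem constantCoeff_qv_pow_wordExponent (k r : Fin d → ℕ) (j : Fin (qword k).length) :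
    (qv d ^ wordExponent k r j).constantCoeff = 0 := by
  have hpos : wordExponent k r j ≠ 0 :=
    (prefixSum_qword_pos k (fun i => (r i).succ_pos) j).ne'
  rw [map_pow, constantCoeff_qv, zero_pow hpos]

/-- The monomials whose double sum is both the `q`-polylogarithm and, up to sign, the iterated
`q`-integral. -/
noncomputable def expansionTerm (k : Fin d → ℕ)
    (x : (Fin d → ℕ) × (Fin (qword k).length → ℕ)) : MvPowerSeries (Fin (d + 1)) ℚ :=
  (∏ i, xv i ^ (x.1 i + 1)) *
    ∏ j : Fin (qword k).length, (qv d ^ wordExponent k x.1 j.rev) ^ x.2 j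

theorem summable_expansionTerm (k : Fin d → ℕ) : Summable (expansionTerm k) :=
  MvPowerSeries.summable_prod_pow_mul_prod_pow (y := xv)
    (z := fun r (j : Fin (qword k).length) => qv d ^ wordExponent k r j.rev) constantCoeff_xv
    fun r j => constantCoeff_qv_pow_wordExponent k r j.rev

theorem expansionTerm_eq {k : Fin d → ℕ} {p : Fin d → Fin (qword k).length}
    (hp : ∀ i, (qword k).get (p i) = some i) (hp' : ∀ j i, (qword k).get j = some i → p i = j)
    (r : Fin d → ℕ) (u : Fin (qword k).length → ℕ) :
    expansionTerm k (r, u) = (∏ i, (qv d ^ prefixSum u (p i).rev * xv i)) *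
      ∏ i, (qv d ^ prefixSum u (p i).rev * xv i) ^ r i := by
  have h1 : ∏ j : Fin (qword k).length, (qv d ^ wordExponent k r j.rev) ^ u j =
      ∏ i, (qv d ^ prefixSum u (p i).rev) ^ (r i + 1) := by
    simp_rw [← pow_mul, wordExponent]
    rw [Finset.prod_pow_eq_pow_sum, ← sum_mul_prefixSum_rev, ← Finset.prod_pow_eq_pow_sum,
      prod_qword_eq_prod hp hp' (fun j a => qv d ^ (letterWeight (fun i => r i + 1) a *
        prefixSum u j.rev)) (by simp [letterWeight])]
    simp [letterWeight, mul_comm]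
  simp only [expansionTerm, h1, ← Finset.prod_mul_distrib]
  refine Finset.prod_congr rfl fun i _ => ?_
  rw [← mul_pow, ← pow_succ', mul_comm (xv i)]

theorem qLi_eq_tsum_expansionTerm (k : Fin d → ℕ) (hk : ∀ i, 1 ≤ k i) :
    qLi k = ∑' x, expansionTerm k x := by
  refine HasSum.tsum_eq ?_
  rw [← (strictMonoEquiv d).hasSum_iff]
  refine (summable_expansionTerm k).hasSum.prod_fiberwise fun r => ?_
  have h := (MvPowerSeries.hasSum_prod_pow fun j =>
    constantCoeff_qv_pow_wordExponent k r j.rev).mul_left (∏ i, xv i ^ (r i + 1))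
  have hv : ((strictMonoEquiv d r).1 : Fin d → ℕ) = prefixSum fun i => r i + 1 := rfl
  have hrev : ∏ j : Fin (qword k).length, Ring.inverse (1 - qv d ^ wordExponent k r j.rev) =
      ∏ i, Ring.inverse (1 - qv d ^ prefixSum (fun i => r i + 1) i) ^ k i :=
    (Equiv.prod_comp Fin.revPerm fun j => Ring.inverse (1 - qv d ^ wordExponent k r j)).trans
      (prod_prefixSum_qword (fun a => Ring.inverse (1 - qv d ^ a)) k hk _)
  rw [hrev, ← Finset.prod_mul_distrib] at h
  refine (congrArg (HasSum _) ?_).mp h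
  refine Finset.prod_congr rfl fun i _ => ?_
  rw [hv, Ring.inverse_pow]
  congr 2
  have := prefixSum_eq_prev_add (fun i => r i + 1) i
  omega

theorem qIint_eq_tsum_expansionTerm (k : Fin d → ℕ) :
    qIint k = (-1) ^ d * ∑' x, expansionTerm k x := by
  obtain ⟨p, hp, hp'⟩ := exists_position_qword k
  refine HasSum.tsum_eq ?_
  rw [← (antitoneEquiv _).hasSum_iff]
  refine (((Equiv.prodComm _ _).hasSum_iff.mpr
    (summable_expansionTerm k).hasSum).mul_left _).prod_fiberwise fun u => ?_
  have h := ((MvPowerSeries.hasSum_prod_pow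
    (y := fun i => qv d ^ prefixSum u (p i).rev * xv i) fun i => by
      simp [constantCoeff_xv]).mul_left
      (∏ i, (qv d ^ prefixSum u (p i).rev * xv i))).mul_left ((-1) ^ d)
  convert h using 1
  · funext r
    exact congrArg _ (expansionTerm_eq hp hp' r u)
  · have hv : (antitoneEquiv _ u).1 = fun j => prefixSum u j.rev := rfl
    simp only [Function.comp_apply, hv]
    rw [prod_qword_eq_prod hp hp' (fun j a => qfactor (prefixSum u j.rev) a) fun _ => rfl]
    simp only [qfactor, neg_mul]
    rw [Finset.prod_neg, Finset.prod_mul_distrib]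
    simp

/-- **`q`-integral expression of multiple `q`-polylogarithms** (Theorem 2.3 of the
paper, after Zhao): `Li_{q;k_1,…,k_d}(z_1,…,z_d) = (−1)^d I_q(0; a_1, 0^{k_1−1}, …,
a_d, 0^{k_d−1}; 1)` with `a_i = 1/(z_i ⋯ z_d)`. -/
theorem qLi_eq_qIint (k : Fin d → ℕ) (hk : ∀ i, 1 ≤ k i) :
    qLi k = (-1 : MvPowerSeries (Fin (d + 1)) ℚ) ^ d * qIint k := by
  rw [qLi_eq_tsum_expansionTerm k hk, qIint_eq_tsum_expansionTerm, ← mul_assoc, ← mul_pow]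
  simp
end

section
/- Bradley–Zhao duality: for integers r ≥ 1 and k_j, l_j ≥ 1 (1 ≤ j ≤ r), define ζ_q^{BZ}(m_1,…,m_s) := Σ_{0<n_1<⋯<n_s} ∏_i q^{(m_i−1)n_i}/(1−q^{n_i})^{m_i} as a formal power series in q. Then ζ_q^{BZ}({1}^{l_1−1}, k_1+1, …, {1}^{l_r−1}, k_r+1) = ζ_q^{BZ}({1}^{k_r−1}, l_r+1, …, {1}^{k_1−1}, l_1+1), where {1}^m denotes m repetitions of the entry 1. -/
/- We endow `ℚ[[q]]` with the product topology (coefficientwise convergence), so that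
the `q`-adically convergent sums of the paper become honest `tsum`s. -/
noncomputable instance : TopologicalSpace (PowerSeries ℚ) :=
  inferInstanceAs (TopologicalSpace ((Unit →₀ ℕ) → ℚ))

instance : T2Space (PowerSeries ℚ) :=
  inferInstanceAs (T2Space ((Unit →₀ ℕ) → ℚ))

/-- The Bradley–Zhao `q`-multiple zeta value
`ζ_q^{BZ}(m_1,…,m_s) = Σ_{0<n_1<⋯<n_s} ∏_i q^{(m_i−1)n_i}/(1−q^{n_i})^{m_i}`
as a formal power series in `q`. -/
noncomputable def zetaBZ (ms : List ℕ) : PowerSeries ℚ :=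
  ∑' n : {n : Fin ms.length → ℕ // StrictMono n ∧ ∀ i, 0 < n i},
    ∏ i : Fin ms.length,
      (PowerSeries.X : PowerSeries ℚ) ^ ((ms.get i - 1) * n.1 i)
        * Ring.inverse ((1 - (PowerSeries.X : PowerSeries ℚ) ^ (n.1 i)) ^ (ms.get i))

namespace BradleyZhao

open PowerSeries Finset

/-- The power series `1 / (1 - q ^ n)` (zero for `n = 0`). -/
noncomputable def geom (n : ℕ) : PowerSeries ℚ := Ring.inverse (1 - X ^ n)

lemma isUnit_one_sub_X_pow {n : ℕ} (hn : n ≠ 0) : IsUnit (1 - X ^ n : PowerSeries ℚ) := by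
  rw [PowerSeries.isUnit_iff_constantCoeff]
  simp [hn]

lemma one_sub_mul_geom {n : ℕ} (hn : n ≠ 0) : (1 - X ^ n) * geom n = 1 :=
  Ring.mul_inverse_cancel _ (isUnit_one_sub_X_pow hn)

lemma geom_zero : geom 0 = 0 := by simp [geom]

/-- The `q`-factorial `∏_{1 ≤ i ≤ n} (1 - q ^ i)`. -/
noncomputable def qFact (n : ℕ) : PowerSeries ℚ := ∏ i ∈ range n, (1 - X ^ (i + 1))

lemma isUnit_qFact (n : ℕ) : IsUnit (qFact n) := by
  unfold qFact
  induction n with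
  | zero => simp
  | succ n ih => rw [prod_range_succ]; exact ih.mul (isUnit_one_sub_X_pow n.succ_ne_zero)

lemma qFact_succ (n : ℕ) : qFact (n + 1) = qFact n * (1 - X ^ (n + 1)) := prod_range_succ _ _

/-- The Seki–Yamamoto connector `q ^ (m n) (q)_m (q)_n / (q)_{m+n}`. -/
noncomputable def connector (m n : ℕ) : PowerSeries ℚ :=
  X ^ (m * n) * qFact m * qFact n * Ring.inverse (qFact (m + n))

lemma connector_comm (m n : ℕ) : connector m n = connector n m := by
  simp only [connector, mul_comm m n, add_comm m n]; ring

lemma connector_zero_left (n : ℕ) : connector 0 n = 1 := by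
  simp only [connector, zero_add, zero_mul, pow_zero, one_mul]
  rw [mul_assoc, Ring.mul_inverse_cancel _ (isUnit_qFact n)]
  simp [qFact]

lemma connector_zero_right (n : ℕ) : connector n 0 = 1 := by
  rw [connector_comm, connector_zero_left]

lemma geom_mul_connector_succ {m : ℕ} (hm : m ≠ 0) (n : ℕ) :
    geom (n + 1) * connector m (n + 1) =
      X ^ m * geom m * (connector m n - connector m (n + 1)) := by
  have h1 := one_sub_mul_geom hm
  have h2 := one_sub_mul_geom n.succ_ne_zero
  have h3 := Ring.mul_inverse_cancel _ (isUnit_qFact (m + n))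
  have h4 := Ring.mul_inverse_cancel _ (isUnit_qFact (m + n + 1))
  have h5 : Ring.inverse (qFact (m + n)) =
      (1 - X ^ (m + n + 1)) * Ring.inverse (qFact (m + n + 1)) := by
    refine (isUnit_qFact (m + n)).mul_left_cancel ?_
    rw [h3, ← mul_assoc, ← qFact_succ, h4]
  simp only [connector, ← add_assoc]
  rw [h5, qFact_succ n]
  generalize Ring.inverse (qFact (m + n + 1)) = I
  simp only [Nat.succ_eq_add_one] at h2
  have e1 : (X : PowerSeries ℚ) ^ (m + n + 1) = X ^ m * X ^ (n + 1) := by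
    rw [add_assoc, pow_add]
  have e2 : (X : PowerSeries ℚ) ^ (m * (n + 1)) = X ^ (m * n) * X ^ m := by
    rw [← pow_add, mul_add_one]
  rw [e1, e2]
  linear_combination (X ^ (m * n) * X ^ m * qFact m * qFact n * I) * (h2 - h1)

lemma sum_geom_mul_connector {m : ℕ} (hm : m ≠ 0) {a N : ℕ} (h : a ≤ N) :
    ∑ n ∈ Ioc a N, geom n * connector m n =
      X ^ m * geom m * (connector m a - connector m N) := by
  induction N, h using Nat.le_induction with
  | base => simp
  | succ N hN ih =>
    rw [← insert_Ioc_right_eq_Ioc_add_one hN, sum_insert (by simp), ih,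
      geom_mul_connector_succ hm]
    ring

lemma X_pow_dvd_connector {m : ℕ} (hm : m ≠ 0) (N : ℕ) : X ^ N ∣ connector m N := by
  simp only [connector, mul_assoc]
  exact (pow_dvd_pow _ (Nat.le_mul_of_pos_left N (Nat.pos_of_ne_zero hm))).mul_right _

/-- Generating series of the chains with last entry `n` for the word read from right to left:
`true` appends a new summation index with weight `1 / (1 - q ^ n)`, and `false` multiplies by
`q ^ n / (1 - q ^ n)` at the last index. -/
noncomputable def endingAt : List Bool → ℕ → PowerSeries ℚ
  | [], n => if n = 0 then 1 else 0
  | true :: w, n => geom n * ∑ a ∈ range n, endingAt w a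
  | false :: w, n => X ^ n * geom n * endingAt w n

lemma endingAt_zero : ∀ {w : List Bool}, w ≠ [] → endingAt w 0 = 0
  | true :: _, _ => by simp [endingAt]
  | false :: _, _ => by simp [endingAt, geom_zero]

lemma sum_endingAt_true_mul (w : List Bool) (N : ℕ) (f : ℕ → PowerSeries ℚ) :
    ∑ n ∈ range (N + 1), endingAt (true :: w) n * f n =
      ∑ a ∈ range (N + 1), endingAt w a * ∑ n ∈ Ioc a N, geom n * f n := by
  simp only [endingAt, mul_sum, sum_mul]
  rw [sum_comm' (t' := range (N + 1)) (s' := fun a => Ioc a N)]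
  · exact sum_congr rfl fun _ _ => sum_congr rfl fun _ _ => by ring
  · intro n a
    simp only [mem_range, mem_Ioc]
    omega

/-- The truncated connected sum of two words. -/
noncomputable def connectedSum (N : ℕ) (w v : List Bool) : PowerSeries ℚ :=
  ∑ m ∈ range (N + 1), ∑ n ∈ range (N + 1), endingAt w m * connector m n * endingAt v n

lemma connectedSum_comm (N : ℕ) (w v : List Bool) :
    connectedSum N w v = connectedSum N v w := by
  unfold connectedSum
  rw [sum_comm]
  exact sum_congr rfl fun m _ => sum_congr rfl fun n _ => by rw [connector_comm]; ring

lemma connectedSum_nil_right (N : ℕ) (w : List Bool) :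
    connectedSum N w [] = ∑ m ∈ range (N + 1), endingAt w m := by
  refine sum_congr rfl fun m _ => ?_
  simp [endingAt, connector_zero_right]

/-- Moving a letter `false` from the left word to a letter `true` of the right word. -/
lemma X_pow_dvd_connectedSum_sub (N : ℕ) {w : List Bool} (hw : w ≠ []) (v : List Bool) :
    X ^ N ∣ connectedSum N (false :: w) v - connectedSum N w (true :: v) := by
  unfold connectedSum
  rw [← sum_sub_distrib]
  refine dvd_sum fun m _ => ?_
  rcases eq_or_ne m 0 with rfl | hm
  · simp [endingAt_zero hw, endingAt_zero (List.cons_ne_nil false w)]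
  have h : ∑ n ∈ range (N + 1), endingAt w m * connector m n * endingAt (true :: v) n =
      ∑ a ∈ range (N + 1),
        endingAt w m * (endingAt v a * (X ^ m * geom m * (connector m a - connector m N))) := by
    have h' : ∑ a ∈ range (N + 1), endingAt v a *
        (X ^ m * geom m * (connector m a - connector m N)) =
        ∑ n ∈ range (N + 1), endingAt (true :: v) n * connector m n := by
      rw [sum_endingAt_true_mul]
      exact sum_congr rfl fun a ha => by
        rw [sum_geom_mul_connector hm (Nat.lt_succ_iff.1 (mem_range.1 ha))]
    rw [← mul_sum, h', mul_sum]
    exact sum_congr rfl fun _ _ => by ring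
  rw [h, ← sum_sub_distrib]
  refine dvd_sum fun a _ => ?_
  have : endingAt (false :: w) m * connector m a * endingAt v a -
      endingAt w m * (endingAt v a * (X ^ m * geom m * (connector m a - connector m N))) =
      connector m N * (endingAt w m * endingAt v a * X ^ m * geom m) := by
    rw [endingAt]; ring
  rw [this]
  exact (X_pow_dvd_connector hm N).mul_right _

lemma X_pow_dvd_connectedSum_sub_nil (N : ℕ) (w : List Bool) {v : List Bool} (hv : v ≠ []) :
    X ^ N ∣ connectedSum N (w ++ [true]) v -
      connectedSum N [] (((w ++ [true]).map not).reverse ++ v) := by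
  have move_true (u : List Bool) {v : List Bool} (hv : v ≠ []) :
      X ^ N ∣ connectedSum N (true :: u) v - connectedSum N u (false :: v) := by
    rw [connectedSum_comm N _ v, connectedSum_comm N u, ← neg_sub, dvd_neg]
    exact X_pow_dvd_connectedSum_sub N hv u
  induction w generalizing v with
  | nil => exact move_true [] hv
  | cons c w ih =>
    have h1 : X ^ N ∣ connectedSum N (c :: (w ++ [true])) v -
        connectedSum N (w ++ [true]) ((!c) :: v) := by
      cases c
      · exact X_pow_dvd_connectedSum_sub N (by simp) v
      · exact move_true _ hv
    have h2 := dvd_add h1 (ih (v := (!c) :: v) (by simp))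
    rw [sub_add_sub_cancel] at h2
    simpa using h2

lemma X_pow_dvd_sum_endingAt_sub (N : ℕ) (w : List Bool) :
    X ^ N ∣ ∑ m ∈ range (N + 1), endingAt (false :: w ++ [true]) m -
      ∑ m ∈ range (N + 1), endingAt (((false :: w ++ [true]).map not).reverse) m := by
  rw [← connectedSum_nil_right, ← connectedSum_nil_right, connectedSum_comm N (List.reverse _)]
  have h := dvd_add (X_pow_dvd_connectedSum_sub N (w := w ++ [true]) (by simp) [])
    (X_pow_dvd_connectedSum_sub_nil N w (List.cons_ne_nil true []))
  rw [sub_add_sub_cancel] at h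
  simpa using h

/-- Generating series of the chains with entries in `(a, N]` for the word read from left to
right. -/
noncomputable def startingAbove (N : ℕ) : List Bool → ℕ → PowerSeries ℚ
  | [], _ => 1
  | true :: w, a => ∑ n ∈ Ioc a N, geom n * startingAbove N w n
  | false :: w, a => X ^ a * geom a * startingAbove N w a

lemma sum_endingAt_reverse_append (N : ℕ) (w v : List Bool) :
    ∑ m ∈ range (N + 1), endingAt (w.reverse ++ v) m =
      ∑ m ∈ range (N + 1), endingAt v m * startingAbove N w m := by
  induction w generalizing v with
  | nil => simp [startingAbove]
  | cons c w ih =>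
    rw [List.reverse_cons, List.append_assoc, List.singleton_append, ih]
    cases c
    · exact sum_congr rfl fun _ _ => by simp only [endingAt, startingAbove]; ring
    · exact sum_endingAt_true_mul v N _

lemma startingAbove_zero (N : ℕ) (w : List Bool) :
    startingAbove N w 0 = ∑ m ∈ range (N + 1), endingAt w.reverse m := by
  rw [← List.append_nil w.reverse, sum_endingAt_reverse_append]
  simp [endingAt]

lemma coeff_startingAbove_dual {d N : ℕ} (h : d < N) (w : List Bool) :
    coeff d (startingAbove N (true :: w ++ [false]) 0) =
      coeff d (startingAbove N (((true :: w ++ [false]).map not).reverse) 0) := by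
  rw [startingAbove_zero, startingAbove_zero, ← sub_eq_zero, ← map_sub]
  have := X_pow_dvd_sum_endingAt_sub N w.reverse
  refine X_pow_dvd_iff.1 ?_ d h
  simpa using this

/-- The word of an index: each entry `m` contributes `true` followed by `m - 1` times `false`. -/
def toWord (ms : List ℕ) : List Bool :=
  ms.flatMap fun m => true :: List.replicate (m - 1) false

/-- The summand of the Bradley–Zhao series for a single entry. -/
noncomputable def factor (m n : ℕ) : PowerSeries ℚ :=
  X ^ ((m - 1) * n) * Ring.inverse ((1 - X ^ n) ^ m)

lemma startingAbove_replicate_append (N j : ℕ) (w : List Bool) (a : ℕ) :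
    startingAbove N (List.replicate j false ++ w) a =
      (X ^ a * geom a) ^ j * startingAbove N w a := by
  induction j with
  | zero => simp
  | succ j ih => rw [List.replicate_succ, List.cons_append, startingAbove, ih]; ring

lemma startingAbove_toWord_cons (N : ℕ) {m : ℕ} (hm : 1 ≤ m) (ms : List ℕ) (a : ℕ) :
    startingAbove N (toWord (m :: ms)) a =
      ∑ n ∈ Ioc a N, factor m n * startingAbove N (toWord ms) n := by
  obtain ⟨j, rfl⟩ := Nat.exists_eq_add_of_le' hm
  simp only [toWord, List.flatMap_cons, List.cons_append, startingAbove,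
    startingAbove_replicate_append, factor, ← Ring.inverse_pow, geom, Nat.add_sub_cancel]
  exact sum_congr rfl fun n _ => by ring

/-- The strictly increasing `s`-tuples with entries in `(a, N]`. -/
def chains (N : ℕ) : (s : ℕ) → ℕ → Finset (Fin s → ℕ)
  | 0, _ => univ
  | s + 1, a => (Ioc a N).biUnion fun n => (chains N s n).image (Fin.cons n)

lemma mem_chains {N s a : ℕ} {n : Fin s → ℕ} :
    n ∈ chains N s a ↔ StrictMono n ∧ ∀ i, a < n i ∧ n i ≤ N := by
  induction s generalizing a with
  | zero => simpa [chains, Subsingleton.strictMono] using Subsingleton.elim _ _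
  | succ s ih =>
    obtain ⟨b, n, rfl⟩ : ∃ b m, n = Fin.cons b m := ⟨n 0, Fin.tail n, (Fin.cons_self_tail n).symm⟩
    simp only [chains, mem_biUnion, mem_image, mem_Ioc, Fin.cons_inj, ih, Fin.forall_fin_succ,
      Fin.cons_zero, Fin.cons_succ]
    have hmono : StrictMono (Fin.cons b n : Fin (s + 1) → ℕ) ↔ (∀ i, b < n i) ∧ StrictMono n := by
      simp [StrictMono, Fin.forall_fin_succ]
    rw [hmono]
    constructor
    · rintro ⟨_, hb, _, ⟨hn, h⟩, rfl, rfl⟩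
      exact ⟨⟨fun i => (h i).1, hn⟩, hb, fun i => ⟨hb.1.trans (h i).1, (h i).2⟩⟩
    · rintro ⟨⟨h, hn⟩, hb, h'⟩
      exact ⟨b, hb, n, ⟨hn, fun i => ⟨h i, (h' i).2⟩⟩, rfl, rfl⟩

lemma sum_chains_prod_factor (N : ℕ) {ms : List ℕ} (hms : ∀ m ∈ ms, 1 ≤ m) (a : ℕ) :
    ∑ n ∈ chains N ms.length a, ∏ i, factor (ms.get i) (n i) =
      startingAbove N (toWord ms) a := by
  induction ms generalizing a with
  | nil => simp [chains, toWord, startingAbove]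
  | cons m ms ih =>
    rw [startingAbove_toWord_cons N (hms m (by simp))]
    refine (sum_biUnion ?_).trans ?_
    rotate_left
    · refine sum_congr rfl fun b _ => ?_
      refine (sum_image (Fin.cons_right_injective (α := fun _ => ℕ) b).injOn).trans ?_
      rw [← ih fun m hm => hms m (by simp [hm]), mul_sum]
      exact sum_congr rfl fun n _ => Fin.prod_univ_succ _
    · intro b _ c _ hbc
      refine disjoint_left.2 fun n hb hc => hbc ?_
      obtain ⟨_, _, rfl⟩ := mem_image.1 hb
      obtain ⟨_, _, h⟩ := mem_image.1 hc
      exact (Fin.cons_inj.1 h).1.symm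

lemma hasSum_of_hasSum_coeff {ι : Type*} {f : ι → PowerSeries ℚ} {g : PowerSeries ℚ}
    (h : ∀ d, HasSum (fun i => coeff d (f i)) (coeff d g)) : HasSum f g := by
  refine (Pi.hasSum (f := (f : ι → (Unit →₀ ℕ) → ℚ))).2 fun e => ?_
  rw [Finsupp.unique_single e]
  exact h _

lemma coeff_prod_factor_eq_zero {ms : List ℕ}
    (hlast : ∀ i : Fin ms.length, i.1 + 1 = ms.length → 2 ≤ ms.get i)
    {n : Fin ms.length → ℕ} (hn : StrictMono n) {d : ℕ} (i : Fin ms.length) (hi : d < n i) :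
    coeff d (∏ i, factor (ms.get i) (n i)) = 0 := by
  have hpos := i.pos
  set j : Fin ms.length := ⟨ms.length - 1, by omega⟩
  have hj : 2 ≤ ms.get j := hlast j (by simp only [j]; omega)
  have hij : d < n j := hi.trans_le (hn.monotone (Fin.le_def.2 (by simp only [j]; omega)))
  refine X_pow_dvd_iff.1 (Dvd.dvd.trans ?_ (dvd_prod_of_mem _ (mem_univ j))) d hij
  exact (pow_dvd_pow _ (Nat.le_mul_of_pos_left _ (by omega))).mul_right _

lemma coeff_zetaBZ {ms : List ℕ} (hms : ∀ m ∈ ms, 1 ≤ m)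
    (hlast : ∀ i : Fin ms.length, i.1 + 1 = ms.length → 2 ≤ ms.get i) (d : ℕ) :
    coeff d (zetaBZ ms) = coeff d (startingAbove (d + 1) (toWord ms) 0) := by
  suffices h : zetaBZ ms = mk fun d => coeff d (startingAbove (d + 1) (toWord ms) 0) by
    rw [h, coeff_mk]
  refine HasSum.tsum_eq (hasSum_of_hasSum_coeff fun d => ?_)
  rw [coeff_mk, ← sum_chains_prod_factor (d + 1) hms, map_sum,
    ← sum_subtype_of_mem (p := fun n => StrictMono n ∧ ∀ i, 0 < n i)
      (fun n => coeff d (∏ i, factor (ms.get i) (n i)))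
      fun n hn => ⟨(mem_chains.1 hn).1, fun i => ((mem_chains.1 hn).2 i).1⟩]
  refine hasSum_sum_of_ne_finset_zero fun n hn => ?_
  obtain ⟨i, hi⟩ : ∃ i, d + 1 < n.1 i := by
    by_contra! h
    exact hn (mem_subtype.2 (mem_chains.2 ⟨n.2.1, fun i => ⟨n.2.2 i, h i⟩⟩))
  exact coeff_prod_factor_eq_zero hlast n.2.1 i (by omega)

/-- The index `({1}^{l_1-1}, k_1+1, …, {1}^{l_r-1}, k_r+1)`. -/
def blocks {r : ℕ} (k l : Fin r → ℕ) : List ℕ :=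
  (List.ofFn fun j : Fin r => List.replicate (l j - 1) 1 ++ [k j + 1]).flatten

lemma one_le_of_mem_blocks {r : ℕ} {k l : Fin r → ℕ} : ∀ m ∈ blocks k l, 1 ≤ m := by
  simp only [blocks, List.mem_flatten, List.mem_ofFn]
  rintro m ⟨_, ⟨j, rfl⟩, hm⟩
  simp only [List.mem_append, List.mem_replicate, List.mem_singleton] at hm
  omega

lemma toWord_blocks {r : ℕ} {k l : Fin r → ℕ} (hl : ∀ j, 1 ≤ l j) :
    toWord (blocks k l) = (List.ofFn fun j : Fin r =>
      List.replicate (l j) true ++ List.replicate (k j) false).flatten := by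
  have h (j : Fin r) : toWord (List.replicate (l j - 1) 1 ++ [k j + 1]) =
      List.replicate (l j) true ++ List.replicate (k j) false := by
    obtain ⟨a, ha⟩ := Nat.exists_eq_add_of_le' (hl j)
    rw [ha, List.replicate_succ']
    simp [toWord, List.flatMap_replicate]
  simp only [← h, blocks, toWord, List.flatMap_def, List.map_flatten, List.map_ofFn,
    List.flatten_flatten]
  rfl

lemma blocks_succ {r : ℕ} (k l : Fin (r + 1) → ℕ) :
    ∃ t, blocks k l = t ++ [k (Fin.last r) + 1] := by
  simp only [blocks, List.ofFn_succ_last, List.flatten_append, List.flatten_singleton]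
  exact ⟨_, (List.append_assoc _ _ _).symm⟩

lemma two_le_last_blocks {r : ℕ} {k l : Fin r → ℕ} (hk : ∀ j, 1 ≤ k j)
    (i : Fin (blocks k l).length) (hi : i.1 + 1 = (blocks k l).length) :
    2 ≤ (blocks k l).get i := by
  cases r with
  | zero => exact absurd i.2 (by simp [blocks])
  | succ r =>
    obtain ⟨t, ht⟩ := blocks_succ k l
    generalize blocks k l = b at *
    subst ht
    obtain rfl : i = ⟨t.length, by simp⟩ := Fin.ext (by simpa using hi)
    simpa using hk _

lemma toWord_blocks_rev {r : ℕ} {k l : Fin r → ℕ} (hk : ∀ j, 1 ≤ k j) (hl : ∀ j, 1 ≤ l j) :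
    toWord (blocks (fun j => l j.rev) fun j => k j.rev) =
      ((toWord (blocks k l)).map not).reverse := by
  have reverse_ofFn (f : Fin r → List Bool) :
      (List.ofFn f).reverse = List.ofFn fun j => f j.rev := by
    refine List.ext_getElem (by simp) fun i _ _ => ?_
    simp only [List.getElem_reverse, List.getElem_ofFn, List.length_ofFn]
    congr 1
    ext
    simp only [Fin.val_rev]
    omega
  rw [toWord_blocks hl, toWord_blocks fun j => hk _, List.map_flatten, List.reverse_flatten,
    List.map_ofFn, List.map_ofFn, reverse_ofFn]
  simp [Function.comp_def]

lemma exists_toWord_blocks {r : ℕ} {k l : Fin (r + 1) → ℕ} (hk : ∀ j, 1 ≤ k j) :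
    ∃ w, toWord (blocks k l) = true :: w ++ [false] := by
  obtain ⟨t, ht⟩ := blocks_succ k l
  obtain ⟨j, hj⟩ := Nat.exists_eq_add_of_le' (hk (Fin.last r))
  rw [ht, hj]
  cases t with
  | nil => exact ⟨List.replicate j false, by simp [toWord, List.replicate_succ']⟩
  | cons m t =>
    exact ⟨List.replicate (m - 1) false ++ toWord t ++ true :: List.replicate j false,
      by simp [toWord, List.replicate_succ']⟩

end BradleyZhao

/-- **Bradley–Zhao duality** (Bradley, Corollary 3): for `k_j, l_j ≥ 1`,
`ζ_q^{BZ}({1}^{l_1−1}, k_1+1, …, {1}^{l_r−1}, k_r+1)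
  = ζ_q^{BZ}({1}^{k_r−1}, l_r+1, …, {1}^{k_1−1}, l_1+1)`. -/
theorem zetaBZ_duality (r : ℕ) (hr : 1 ≤ r) (k l : Fin r → ℕ)
    (hk : ∀ j, 1 ≤ k j) (hl : ∀ j, 1 ≤ l j) :
    zetaBZ ((List.ofFn (fun j : Fin r =>
        List.replicate (l j - 1) 1 ++ [k j + 1])).flatten)
      = zetaBZ ((List.ofFn (fun j : Fin r =>
        List.replicate (k (Fin.rev j) - 1) 1 ++ [l (Fin.rev j) + 1])).flatten) := by
  obtain ⟨r, rfl⟩ := Nat.exists_eq_add_of_le' hr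
  ext d
  refine (BradleyZhao.coeff_zetaBZ BradleyZhao.one_le_of_mem_blocks
    (BradleyZhao.two_le_last_blocks hk) d).trans (Eq.trans ?_
    (BradleyZhao.coeff_zetaBZ BradleyZhao.one_le_of_mem_blocks
      (BradleyZhao.two_le_last_blocks fun j => hl j.rev) d).symm)
  obtain ⟨w, hw⟩ := BradleyZhao.exists_toWord_blocks (l := l) hk
  rw [BradleyZhao.toWord_blocks_rev hk hl, hw]
  exact BradleyZhao.coeff_startingAbove_dual d.lt_succ_self w
end

section
/- Schlesinger–Zudilin duality: for integers r ≥ 1 and k_j, l_j ≥ 1, define ζ_q^{SZ}(m_1,…,m_s) := Σ_{0<n_1<⋯<n_s} ∏_i (q^{n_i}/(1−q^{n_i}))^{m_i} as a formal power series in q (allowing m_i ≥ 0). Then ζ_q^{SZ}({0}^{l_1−1}, k_1, …, {0}^{l_r−1}, k_r) = ζ_q^{SZ}({0}^{k_r−1}, l_r, …, {0}^{k_1−1}, l_1). -/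
/-- The Schlesinger–Zudilin `q`-multiple zeta value
`ζ_q^{SZ}(m_1,…,m_s) = Σ_{0<n_1<⋯<n_s} ∏_i (q^{n_i}/(1−q^{n_i}))^{m_i}`
as a formal power series in `q` (entries `m_i ≥ 0` allowed; entries equal to `0`
contribute a factor `1` but still index a summation variable). -/
noncomputable def zetaSZ (ms : List ℕ) : PowerSeries ℚ :=
  ∑' n : {n : Fin ms.length → ℕ // StrictMono n ∧ ∀ i, 0 < n i},
    ∏ i : Fin ms.length,
      ((PowerSeries.X : PowerSeries ℚ) ^ (n.1 i)
        * Ring.inverse (1 - (PowerSeries.X : PowerSeries ℚ) ^ (n.1 i))) ^ (ms.get i)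

/-- The series `q ^ n / (1 - q ^ n)`, over an arbitrary semiring. -/
noncomputable def geomTail (R : Type*) [Semiring R] (n : ℕ) : PowerSeries R :=
  PowerSeries.mk fun d => if n ∣ d ∧ 0 < d then 1 else 0

theorem map_geomTail {R S : Type*} [Semiring R] [Semiring S] (f : R →+* S) (n : ℕ) :
    PowerSeries.map f (geomTail R n) = geomTail S n := by
  ext d
  simp only [geomTail, PowerSeries.coeff_map, PowerSeries.coeff_mk]
  split_ifs <;> simp

theorem geomTail_eq {R : Type*} [Semiring R] {n : ℕ} (hn : 0 < n) :
    geomTail R n = PowerSeries.X ^ n * (1 + geomTail R n) := by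
  ext d
  rw [PowerSeries.coeff_X_pow_mul']
  simp only [geomTail, map_add, PowerSeries.coeff_mk, PowerSeries.coeff_one]
  rcases lt_trichotomy d n with h | rfl | h
  · have : ¬ (n ∣ d ∧ 0 < d) := fun ⟨h1, h2⟩ => by have := Nat.le_of_dvd h2 h1; omega
    simp [this, Nat.not_le.2 h]
  · simp [hn]
  · have h1 : n ∣ d ↔ n ∣ d - n := by rw [Nat.dvd_sub_self_right]; omega
    have h2 : d - n ≠ 0 := by omega
    have h3 : 0 < d - n := by omega
    have h4 : 0 < d := by omega
    simp [← h1, h2, h3, h4, h.le]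

theorem X_pow_dvd_geomTail {R : Type*} [Semiring R] {n : ℕ} (hn : 0 < n) :
    PowerSeries.X ^ n ∣ geomTail R n :=
  ⟨_, geomTail_eq hn⟩

theorem X_pow_mul_inverse_eq_geomTail {n : ℕ} (hn : 0 < n) :
    (PowerSeries.X : PowerSeries ℚ) ^ n * Ring.inverse (1 - (PowerSeries.X : PowerSeries ℚ) ^ n)
      = geomTail ℚ n := by
  have hu : IsUnit (1 - (PowerSeries.X : PowerSeries ℚ) ^ n) := by
    rw [PowerSeries.isUnit_iff_constantCoeff]
    simp [hn.ne']
  have h : geomTail ℚ n * (1 - (PowerSeries.X : PowerSeries ℚ) ^ n) = PowerSeries.X ^ n := by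
    linear_combination geomTail_eq (R := ℚ) hn
  nth_rw 1 [← h]
  rw [mul_assoc, Ring.mul_inverse_cancel _ hu, mul_one]

/-! ### Unconditional sums of power series over `ℝ≥0∞` -/

/-- The coefficientwise sum of a family of power series over `ℝ≥0∞`. -/
noncomputable def seriesSum {ι : Type*} (f : ι → PowerSeries ENNReal) : PowerSeries ENNReal :=
  PowerSeries.mk fun d => ∑' i, PowerSeries.coeff d (f i)

theorem coeff_seriesSum {ι : Type*} (f : ι → PowerSeries ENNReal) (d : ℕ) :
    PowerSeries.coeff d (seriesSum f) = ∑' i, PowerSeries.coeff d (f i) := by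
  simp [seriesSum]

theorem seriesSum_mul_left {ι : Type*} (g : PowerSeries ENNReal) (f : ι → PowerSeries ENNReal) :
    seriesSum (fun i => g * f i) = g * seriesSum f := by
  ext d
  simp only [coeff_seriesSum, PowerSeries.coeff_mul]
  rw [Summable.tsum_finsetSum fun _ _ => ENNReal.summable]
  simp only [ENNReal.tsum_mul_left]

theorem seriesSum_mul_right {ι : Type*} (g : PowerSeries ENNReal) (f : ι → PowerSeries ENNReal) :
    seriesSum (fun i => f i * g) = seriesSum f * g := by
  simp only [mul_comm _ g, seriesSum_mul_left]

theorem seriesSum_comm {ι κ : Type*} (f : ι → κ → PowerSeries ENNReal) :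
    seriesSum (fun i => seriesSum (f i)) = seriesSum fun j => seriesSum fun i => f i j := by
  ext d
  simp only [coeff_seriesSum]
  exact ENNReal.tsum_comm

theorem seriesSum_prod {ι κ : Type*} (f : ι × κ → PowerSeries ENNReal) :
    seriesSum f = seriesSum fun i => seriesSum fun j => f (i, j) := by
  ext d
  simp only [coeff_seriesSum]
  exact ENNReal.tsum_prod'

theorem seriesSum_sigma {ι : Type*} {κ : ι → Type*} (f : (Σ i, κ i) → PowerSeries ENNReal) :
    seriesSum f = seriesSum fun i => seriesSum fun j => f ⟨i, j⟩ := by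
  ext d
  simp only [coeff_seriesSum]
  exact ENNReal.tsum_sigma' _

theorem seriesSum_equiv {ι κ : Type*} (e : ι ≃ κ) (f : κ → PowerSeries ENNReal) :
    seriesSum (fun i => f (e i)) = seriesSum f := by
  ext d
  simp only [coeff_seriesSum]
  exact e.tsum_eq fun j => PowerSeries.coeff d (f j)

theorem seriesSum_unique {ι : Type*} [Unique ι] (f : ι → PowerSeries ENNReal) :
    seriesSum f = f default := by
  ext d
  simp [coeff_seriesSum, tsum_fintype]

theorem coeff_natCast_mul {R : Type*} [Semiring R] (n d : ℕ) (f : PowerSeries R) :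
    PowerSeries.coeff d ((n : PowerSeries R) * f) = n * PowerSeries.coeff d f := by
  rw [← nsmul_eq_mul, map_nsmul, nsmul_eq_mul]

theorem sum_antidiagonal_choose_snd (n p : ℕ) :
    ∑ x ∈ Finset.HasAntidiagonal.antidiagonal n, x.2.choose p = (n + 1).choose (p + 1) := by
  induction n with
  | zero => cases p <;> simp [Nat.choose_eq_zero_of_lt]
  | succ n ih => rw [Finset.Nat.sum_antidiagonal_succ, ih, ← Nat.choose_succ_succ']

theorem tsum_tsum_choose_mul (p : ℕ) (f : ℕ → ENNReal) :
    ∑' i, ∑' a : ℕ, (a.choose p : ENNReal) * f (i + a + 1)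
      = ∑' a : ℕ, (a.choose (p + 1) : ENNReal) * f a := by
  rw [← ENNReal.tsum_prod (f := fun i a : ℕ => (a.choose p : ENNReal) * f (i + a + 1)),
    ← Finset.HasAntidiagonal.sigmaAntidiagonalEquivProd.tsum_eq, ENNReal.tsum_sigma',
    tsum_eq_zero_add' (f := fun a : ℕ => (a.choose (p + 1) : ENNReal) * f a) ENNReal.summable]
  simp only [Nat.choose_zero_succ, Nat.cast_zero, zero_mul, zero_add]
  congr 1
  ext n
  rw [tsum_fintype, Finset.univ_eq_attach, ← sum_antidiagonal_choose_snd, Nat.cast_sum,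
    Finset.sum_mul, ← Finset.sum_attach (Finset.HasAntidiagonal.antidiagonal n)]
  refine Finset.sum_congr rfl fun x _ => ?_
  have := Finset.HasAntidiagonal.mem_antidiagonal.1 x.2
  simp [Finset.HasAntidiagonal.sigmaAntidiagonalEquivProd, this]

theorem seriesSum_seriesSum_choose_mul (p : ℕ) (F : ℕ → PowerSeries ENNReal) :
    seriesSum (fun i : ℕ => seriesSum fun a : ℕ => (a.choose p : PowerSeries ENNReal) * F (i + a + 1))
      = seriesSum fun a : ℕ => (a.choose (p + 1) : PowerSeries ENNReal) * F a := by
  ext d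
  simp only [coeff_seriesSum, coeff_natCast_mul]
  exact tsum_tsum_choose_mul p fun a => PowerSeries.coeff d (F a)

theorem geomTail_eq_seriesSum {n : ℕ} (hn : 0 < n) :
    geomTail ENNReal n = seriesSum fun b : ℕ => PowerSeries.X ^ (n * (b + 1)) := by
  ext d
  simp only [geomTail, coeff_seriesSum, PowerSeries.coeff_mk, PowerSeries.coeff_X_pow]
  split_ifs with h
  · obtain ⟨⟨c, rfl⟩, hc⟩ := h
    obtain ⟨b, rfl⟩ := Nat.exists_eq_succ_of_ne_zero (Nat.pos_of_mul_pos_left hc).ne'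
    rw [tsum_eq_single b]
    · simp
    · intro b' hb'
      rw [if_neg]
      intro h
      have := Nat.eq_of_mul_eq_mul_left hn h
      omega
  · symm
    rw [ENNReal.tsum_eq_zero]
    intro b
    rw [if_neg]
    rintro rfl
    exact h ⟨dvd_mul_right _ _, by positivity⟩

theorem geomTail_pow_succ {n : ℕ} (hn : 0 < n) (t : ℕ) :
    geomTail ENNReal n ^ (t + 1)
      = seriesSum fun b : ℕ => (b.choose t : PowerSeries ENNReal) * PowerSeries.X ^ (n * (b + 1)) := by
  induction t with
  | zero => simp [geomTail_eq_seriesSum hn]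
  | succ t ih =>
    rw [← seriesSum_seriesSum_choose_mul, pow_succ', ih, geomTail_eq_seriesSum hn,
      ← seriesSum_mul_right]
    refine congrArg _ (funext fun i => ?_)
    rw [← seriesSum_mul_left]
    refine congrArg _ (funext fun b => ?_)
    ring

/-! ### Nested sums -/

/-- The nested sum `∑_{c < n_1 < ⋯ < n_s} ∏ (q ^ n_i / (1 - q ^ n_i)) ^ m_i` over `ℝ≥0∞`. -/
noncomputable def nestedSum : List ℕ → ℕ → PowerSeries ENNReal
  | [], _ => 1
  | m :: ms, c => seriesSum fun a : ℕ =>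
      geomTail ENNReal (c + 1 + a) ^ m * nestedSum ms (c + 1 + a)

/-- The product indexed by a chain `n` in a Schlesinger–Zudilin sum. -/
noncomputable def chainTerm (R : Type*) [CommSemiring R] (ms : List ℕ) (n : Fin ms.length → ℕ) :
    PowerSeries R :=
  ∏ i, geomTail R (n i) ^ ms.get i

theorem map_chainTerm {R S : Type*} [CommSemiring R] [CommSemiring S] (f : R →+* S)
    (ms : List ℕ) (n : Fin ms.length → ℕ) :
    PowerSeries.map f (chainTerm R ms n) = chainTerm S ms n := by
  simp [chainTerm, map_prod, map_geomTail]

/-- Splitting off the smallest element of a strictly increasing chain above `c`. -/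
noncomputable def chainConsEquiv (s c : ℕ) :
    (Σ a : ℕ, {n : Fin s → ℕ // StrictMono n ∧ ∀ i, c + 1 + a < n i}) ≃
      {n : Fin (s + 1) → ℕ // StrictMono n ∧ ∀ i, c < n i} where
  toFun x := ⟨Fin.cons (c + 1 + x.1) x.2.1, by
    refine ⟨fun i j hij => ?_, fun i => ?_⟩
    · cases j using Fin.cases with
      | zero => simp at hij
      | succ j =>
        cases i using Fin.cases with
        | zero => simpa using x.2.2.2 j
        | succ i => simpa using x.2.2.1 (Fin.succ_lt_succ_iff.1 hij)
    · cases i using Fin.cases with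
      | zero => simp; omega
      | succ i => have := x.2.2.2 i; simp; omega⟩
  invFun n := ⟨n.1 0 - (c + 1), Fin.tail n.1, fun i j hij => n.2.1 (Fin.succ_lt_succ_iff.2 hij),
    fun i => by
      have := n.2.2 0
      have := n.2.1 (Fin.succ_pos i)
      simp only [Fin.tail]; omega⟩
  left_inv := by
    rintro ⟨a, n, hn⟩
    refine Sigma.ext (by simp) ?_
    have : (c + 1 + a) - (c + 1) = a := by omega
    simp only [Fin.tail_cons]
    congr!
  right_inv := by
    rintro ⟨n, hn⟩
    have := hn.2 0
    have h : c + 1 + (n 0 - (c + 1)) = n 0 := by omega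
    simp [h, Fin.cons_self_tail]

theorem nestedSum_eq_seriesSum_chainTerm (ms : List ℕ) (c : ℕ) :
    nestedSum ms c
      = seriesSum fun n : {n : Fin ms.length → ℕ // StrictMono n ∧ ∀ i, c < n i} =>
          chainTerm ENNReal ms n.1 := by
  induction ms generalizing c with
  | nil =>
    let u : Unique {n : Fin ([] : List ℕ).length → ℕ // StrictMono n ∧ ∀ i, c < n i} :=
      { default := ⟨fun i => i.elim0, fun i => i.elim0, fun i => i.elim0⟩
        uniq := fun n => Subtype.ext (funext fun i => i.elim0) }
    rw [seriesSum_unique]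
    simp [nestedSum, chainTerm]
  | cons m ms ih =>
    rw [← seriesSum_equiv (chainConsEquiv ms.length c), seriesSum_sigma, nestedSum]
    refine congrArg _ (funext fun a => ?_)
    rw [ih, ← seriesSum_mul_left]
    refine congrArg _ (funext fun n => ?_)
    exact (Fin.prod_univ_succ (n := ms.length) fun i : Fin (ms.length + 1) =>
      geomTail ENNReal ((chainConsEquiv ms.length c ⟨a, n⟩).1 i) ^ (m :: ms).get i).symm

theorem nestedSum_replicate_zero_append (p m : ℕ) (ms : List ℕ) (c : ℕ) :
    nestedSum (List.replicate p 0 ++ m :: ms) c = seriesSum fun a : ℕ =>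
      (a.choose p : PowerSeries ENNReal)
        * (geomTail ENNReal (c + 1 + a) ^ m * nestedSum ms (c + 1 + a)) := by
  induction p generalizing c with
  | zero => simp [nestedSum]
  | succ p ih =>
    rw [← seriesSum_seriesSum_choose_mul, List.replicate_succ, List.cons_append, nestedSum]
    refine congrArg _ (funext fun i => ?_)
    rw [pow_zero, one_mul, ih]
    refine congrArg _ (funext fun a => ?_)
    rw [show c + 1 + i + 1 + a = c + 1 + (i + a + 1) by omega]

/-! ### The two-parameter sum exhibiting the duality -/

/-- The sum over `a_j, b_j ≥ 0` of `∏ (a_j choose p_j) (b_j choose t_j)` times `q` to the power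
`∑_{i ≤ j} (a_i + 1) (b_j + 1) + c ∑ (b_j + 1) + e ∑ (a_j + 1)`, where `L` lists the
pairs `(p_j, t_j)`. -/
noncomputable def blockSum : List (ℕ × ℕ) → ℕ → ℕ → PowerSeries ENNReal
  | [], _, _ => 1
  | x :: L, c, e => seriesSum fun y : ℕ × ℕ =>
      (y.1.choose x.1 : PowerSeries ENNReal) * (y.2.choose x.2 : PowerSeries ENNReal)
        * PowerSeries.X ^ ((c + 1 + y.1) * (y.2 + 1) + e * (y.1 + 1))
        * blockSum L (c + 1 + y.1) e

theorem blockSum_append_singleton (L : List (ℕ × ℕ)) (x : ℕ × ℕ) (c e : ℕ) :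
    blockSum (L ++ [x]) c e = seriesSum fun y : ℕ × ℕ =>
      (y.1.choose x.1 : PowerSeries ENNReal) * (y.2.choose x.2 : PowerSeries ENNReal)
        * PowerSeries.X ^ ((c + 1 + y.1) * (y.2 + 1) + e * (y.1 + 1))
        * blockSum L c (e + 1 + y.2) := by
  induction L generalizing c with
  | nil => simp [blockSum]
  | cons z L ih =>
    rw [List.cons_append, blockSum]
    simp only [ih, blockSum, ← seriesSum_mul_left]
    rw [seriesSum_comm]
    refine congrArg _ (funext fun y => congrArg _ (funext fun w => ?_))
    ring

theorem blockSum_reverse_map_swap (L : List (ℕ × ℕ)) (c e : ℕ) :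
    blockSum (L.map Prod.swap).reverse e c = blockSum L c e := by
  induction L generalizing c with
  | nil => simp [blockSum]
  | cons x L ih =>
    rw [List.map_cons, List.reverse_cons, blockSum_append_singleton, blockSum,
      ← seriesSum_equiv (Equiv.prodComm ℕ ℕ)]
    refine congrArg _ (funext fun y => ?_)
    simp only [Equiv.prodComm_apply, Prod.fst_swap, Prod.snd_swap, ih]
    ring

theorem nestedSum_flatten (L : List (ℕ × ℕ)) (c : ℕ) :
    nestedSum (L.map fun x => List.replicate x.1 0 ++ [x.2 + 1]).flatten c = blockSum L c 0 := by
  induction L generalizing c with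
  | nil => simp [nestedSum, blockSum]
  | cons x L ih =>
    rw [List.map_cons, List.flatten_cons, List.append_assoc, List.singleton_append,
      nestedSum_replicate_zero_append, blockSum, seriesSum_prod]
    refine congrArg _ (funext fun a => ?_)
    rw [ih, geomTail_pow_succ (by omega), ← seriesSum_mul_right, ← seriesSum_mul_left]
    refine congrArg _ (funext fun b => ?_)
    ring

/-! ### Comparison with `zetaSZ` -/

theorem finite_setOf_coeff_chainTerm_ne_zero {R : Type*} [CommSemiring R] (ms : List ℕ) (m d : ℕ) :
    {n : {n : Fin (ms ++ [m + 1]).length → ℕ // StrictMono n ∧ ∀ i, 0 < n i} |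
      PowerSeries.coeff d (chainTerm R (ms ++ [m + 1]) n.1) ≠ 0}.Finite := by
  let j : Fin (ms ++ [m + 1]).length := ⟨ms.length, by simp⟩
  have hj : ∀ i, i ≤ j := fun i => by
    have := i.2
    simp only [List.length_append, List.length_singleton] at this
    exact Fin.le_def.2 (Nat.lt_succ_iff.1 this)
  refine Set.Finite.of_finite_image (f := Subtype.val) ?_ Subtype.val_injective.injOn
  refine (Set.Finite.pi' fun _ => Set.finite_Iic d).subset ?_
  rintro _ ⟨n, hn, rfl⟩ i
  refine (n.2.1.monotone (hj i)).trans ?_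
  by_contra! h
  refine hn (PowerSeries.X_pow_dvd_iff.1 ?_ d h)
  refine (X_pow_dvd_geomTail (n.2.2 j)).trans
    (dvd_trans ?_ (Finset.dvd_prod_of_mem _ (Finset.mem_univ j)))
  exact dvd_pow_self _ (by simp [j])

theorem hasSum_of_coeff {ι : Type*} {f : ι → PowerSeries ℚ} {g : PowerSeries ℚ}
    (h : ∀ d, HasSum (fun i => PowerSeries.coeff d (f i)) (PowerSeries.coeff d g)) :
    HasSum f g := by
  refine Pi.hasSum (f := fun i => (f i : (Unit →₀ ℕ) → ℚ)) |>.2 fun x => ?_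
  have := h (x ())
  rwa [PowerSeries.coeff_def rfl] at this

theorem coeff_zetaSZ (ms : List ℕ) (m d : ℕ) :
    ∃ N : ℕ, PowerSeries.coeff d (zetaSZ (ms ++ [m + 1])) = N ∧
      PowerSeries.coeff d (nestedSum (ms ++ [m + 1]) 0) = N := by
  have hfin := finite_setOf_coeff_chainTerm_ne_zero (R := ℕ) ms m
  have hsum {R : Type} [CommSemiring R] [TopologicalSpace R] (d : ℕ) :
      HasSum (fun n : {n : Fin (ms ++ [m + 1]).length → ℕ // StrictMono n ∧ ∀ i, 0 < n i} =>
        PowerSeries.coeff d (chainTerm R (ms ++ [m + 1]) n.1))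
        ((∑ n ∈ (hfin d).toFinset, PowerSeries.coeff d (chainTerm ℕ (ms ++ [m + 1]) n.1) : ℕ) : R) := by
    have hc (n) : PowerSeries.coeff d (chainTerm R (ms ++ [m + 1]) n)
        = ((PowerSeries.coeff d (chainTerm ℕ (ms ++ [m + 1]) n) : ℕ) : R) := by
      rw [← map_chainTerm (Nat.castRingHom R), PowerSeries.coeff_map, eq_natCast]
    simp only [hc, Nat.cast_sum]
    refine hasSum_sum_of_ne_finset_zero fun n hn => ?_
    have : PowerSeries.coeff d (chainTerm ℕ (ms ++ [m + 1]) n.1) = 0 := by simpa using hn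
    rw [this, Nat.cast_zero]
  refine ⟨∑ n ∈ (hfin d).toFinset, PowerSeries.coeff d (chainTerm ℕ (ms ++ [m + 1]) n.1), ?_⟩
  rw [and_comm]
  constructor
  · rw [nestedSum_eq_seriesSum_chainTerm, coeff_seriesSum]
    exact (hsum (R := ENNReal) d).tsum_eq
  · have hz : zetaSZ (ms ++ [m + 1]) = PowerSeries.mk fun d =>
        ((∑ n ∈ (hfin d).toFinset, PowerSeries.coeff d (chainTerm ℕ (ms ++ [m + 1]) n.1) : ℕ) : ℚ) := by
      refine HasSum.tsum_eq (hasSum_of_coeff fun d => ?_)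
      rw [PowerSeries.coeff_mk]
      refine (congrArg (HasSum · _) (funext fun n => congrArg _ ?_)).mpr (hsum (R := ℚ) d)
      exact Finset.prod_congr rfl fun i _ => by rw [X_pow_mul_inverse_eq_geomTail (n.2.2 i)]
    rw [hz, PowerSeries.coeff_mk]

theorem zetaSZ_eq_of_nestedSum_eq {ms ms' : List ℕ} {m m' : ℕ}
    (h : nestedSum (ms ++ [m + 1]) 0 = nestedSum (ms' ++ [m' + 1]) 0) :
    zetaSZ (ms ++ [m + 1]) = zetaSZ (ms' ++ [m' + 1]) := by
  ext d
  obtain ⟨N, h1, h2⟩ := coeff_zetaSZ ms m d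
  obtain ⟨N', h1', h2'⟩ := coeff_zetaSZ ms' m' d
  rw [h1, h1']
  rw [h, h2'] at h2
  exact_mod_cast h2.symm

theorem exists_flatten_eq_append_singleton {L : List (ℕ × ℕ)} (hL : L ≠ []) :
    ∃ ms m, (L.map fun x => List.replicate x.1 0 ++ [x.2 + 1]).flatten = ms ++ [m + 1] := by
  obtain ⟨L', x, rfl⟩ := (List.eq_nil_or_concat' L).resolve_left hL
  exact ⟨(L'.map fun x => List.replicate x.1 0 ++ [x.2 + 1]).flatten ++ List.replicate x.1 0, x.2,
    by simp⟩

/-- Duality, with the index written as a list of pairs `(l_j - 1, k_j - 1)`. -/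
theorem zetaSZ_flatten_reverse_map_swap {L : List (ℕ × ℕ)} (hL : L ≠ []) :
    zetaSZ (L.map fun x => List.replicate x.1 0 ++ [x.2 + 1]).flatten
      = zetaSZ ((L.map Prod.swap).reverse.map fun x => List.replicate x.1 0 ++ [x.2 + 1]).flatten := by
  have h := (nestedSum_flatten L 0).trans
    ((blockSum_reverse_map_swap L 0 0).symm.trans (nestedSum_flatten _ 0).symm)
  obtain ⟨ms, m, h1⟩ := exists_flatten_eq_append_singleton hL
  obtain ⟨ms', m', h2⟩ := exists_flatten_eq_append_singleton
    (L := (L.map Prod.swap).reverse) (by simpa using hL)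
  rw [h1, h2] at h ⊢
  exact zetaSZ_eq_of_nestedSum_eq h

/-- **Schlesinger–Zudilin duality** (Zhao, Theorem 8.3): for `k_j, l_j ≥ 1`,
`ζ_q^{SZ}({0}^{l_1−1}, k_1, …, {0}^{l_r−1}, k_r)
  = ζ_q^{SZ}({0}^{k_r−1}, l_r, …, {0}^{k_1−1}, l_1)`. -/
theorem zetaSZ_duality (r : ℕ) (hr : 1 ≤ r) (k l : Fin r → ℕ)
    (hk : ∀ j, 1 ≤ k j) (hl : ∀ j, 1 ≤ l j) :
    zetaSZ ((List.ofFn (fun j : Fin r =>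
        List.replicate (l j - 1) 0 ++ [k j])).flatten)
      = zetaSZ ((List.ofFn (fun j : Fin r =>
        List.replicate (k (Fin.rev j) - 1) 0 ++ [l (Fin.rev j)])).flatten) := by
  have h := zetaSZ_flatten_reverse_map_swap
    (L := List.ofFn fun j : Fin r => (l j - 1, k j - 1)) (by simp; omega)
  have hrev : ((List.ofFn fun j : Fin r => (l j - 1, k j - 1)).map Prod.swap).reverse
      = List.ofFn fun j : Fin r => (k j.rev - 1, l j.rev - 1) := by
    refine List.ext_getElem (by simp) fun i h1 h2 => ?_
    simp [Fin.rev, Nat.sub_sub, Nat.add_comm 1 i]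
  rw [hrev, List.map_ofFn, List.map_ofFn] at h
  simpa only [Function.comp_def, Nat.sub_add_cancel (hk _), Nat.sub_add_cancel (hl _)] using h
end

section
/- Duality at A=0, B=C=∞, D=1: with f : admissible words → ℚ[[q]] as defined by f(e_{u_1v_1}⋯e_{u_kv_k}) = I_q(0; [u_1^{(1)},v_1^{(1)}],…,[u_k^{(k)},v_k^{(k)}]; 1), where A^{(j)}=0, B^{(j)}=C^{(j)}=∞, D^{(j)} = q^{−#{h≥j : u_hv_h ∈ {AB,AC,BC}}}, and τ the anti-automorphism of words with τ(e_{uv}) = e_{σ(v)σ(u)}, σ = (A D)(B C), one has f(w) = f(τ(w)) for every admissible word w. -/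
/-- The six formal letters `e_{AB}, e_{AC}, e_{AD}, e_{BC}, e_{BD}, e_{CD}`. -/
inductive Letter : Type
  | AB | AC | AD | BC | BD | CD
  deriving DecidableEq

/-- A word is admissible if it does not begin with a letter `e_{Av}` and does not end
with a letter `e_{uD}`. -/
def AdmissibleWord (w : List Letter) : Prop :=
  (∀ u ∈ w.head?, u ∉ [Letter.AB, Letter.AC, Letter.AD]) ∧
  (∀ u ∈ w.getLast?, u ∉ [Letter.AD, Letter.BD, Letter.CD])

/-- Whether a letter lies in `{AB, AC, BC}` (these are the letters contributing to the
shift of `D`). -/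
def Letter.isUpper : Letter → Bool
  | .AB => true | .AC => true | .BC => true | _ => false

/-- `#{h ≥ j : u_h ∈ {AB, AC, BC}}` (0-indexed, `h ≥ j` inclusive), so that
`D^{(j)} = q^{−dsh w j}`. -/
def dsh (w : List Letter) (j : ℕ) : ℕ := ((w.drop j).countP Letter.isUpper)

/-- The factor of the iterated `q`-integral at specialization `A = 0`, `B = C = ∞`,
`D^{(j)} = q^{−c}`, for chain point `t = q^m` and `e = m + c`: with the conventions
`t/(t−0) = 1` and `t/(t−∞) = 0`, the bracket `[u,v]` contributes
`t/(t−u) − t/(t−v)`, namely `1` for `e_{AB}, e_{AC}`, `0` for `e_{BC}`,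
`1 + q^e(1−q^e)^{−1}` for `e_{AD}`, and `q^e(1−q^e)^{−1}` for `e_{BD}, e_{CD}`. -/
noncomputable def lfactor : Letter → ℕ → PowerSeries ℚ
  | .AB => fun _ => 1
  | .AC => fun _ => 1
  | .BC => fun _ => 0
  | .AD => fun e => 1 + (PowerSeries.X : PowerSeries ℚ) ^ e
      * Ring.inverse (1 - (PowerSeries.X : PowerSeries ℚ) ^ e)
  | .BD => fun e => (PowerSeries.X : PowerSeries ℚ) ^ e
      * Ring.inverse (1 - (PowerSeries.X : PowerSeries ℚ) ^ e)
  | .CD => fun e => (PowerSeries.X : PowerSeries ℚ) ^ e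
      * Ring.inverse (1 - (PowerSeries.X : PowerSeries ℚ) ^ e)

/-- `f(w) = I_q(0; [u_1^{(1)},v_1^{(1)}],…,[u_k^{(k)},v_k^{(k)}]; 1) ∈ ℚ[[q]]` at the
specialization `A = 0`, `B = C = ∞`, `D = 1`: the sum over chains
`t_1 ⊴ ⋯ ⊴ t_k ⊴ 1` in `{q^m : m ≥ 0}` (i.e. `t_j = q^{m_j}` with
`m_1 ≥ ⋯ ≥ m_k ≥ 0`) of the product of the factors above. -/
noncomputable def fword (w : List Letter) : PowerSeries ℚ :=
  ∑' m : {m : Fin w.length → ℕ // Antitone m},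
    ∏ j : Fin w.length, lfactor (w.get j) (m.1 j + dsh w (j : ℕ))

/-- The letter `e_{σ(v)σ(u)}` obtained from `e_{uv}` by the involution
`σ = (A D)(B C)`. -/
def Letter.dual : Letter → Letter
  | .AB => .CD | .AC => .BD | .AD => .AD | .BC => .BC | .BD => .AC | .CD => .AB

/-- The anti-automorphism `τ` on words: reverse the word and dualize each letter. -/
def tauWord (w : List Letter) : List Letter := (w.map Letter.dual).reverse

open PowerSeries Finset

lemma one_sub_X_pow_mul_inverse {n : ℕ} (hn : 0 < n) :
    (1 - (X : PowerSeries ℚ) ^ n) * Ring.inverse (1 - (X : PowerSeries ℚ) ^ n) = 1 := by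
  apply Ring.mul_inverse_cancel
  rw [PowerSeries.isUnit_iff_constantCoeff]
  simp [hn.ne']

/-- The reciprocal `1 / ((1 - q) ⋯ (1 - q ^ n))` of the `q`-Pochhammer symbol. -/
noncomputable def invPochhammer (n : ℕ) : PowerSeries ℚ :=
  ∏ j ∈ range n, Ring.inverse (1 - (X : PowerSeries ℚ) ^ (j + 1))

/-- The product `(1 - q ^ m) ⋯ (1 - q ^ (N - 1))`. -/
noncomputable def tailPochhammer (N m : ℕ) : PowerSeries ℚ :=
  ∏ j ∈ Ico m N, (1 - (X : PowerSeries ℚ) ^ j)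

/-- The decrement in the second variable of the connector. -/
noncomputable def connectorStep (N m n : ℕ) : PowerSeries ℚ :=
  tailPochhammer N m * X ^ (m * n) * invPochhammer n

/-- The kernel connecting the two words in the connected sum. -/
noncomputable def connector (N m n : ℕ) : PowerSeries ℚ :=
  1 - ∑ k ∈ range n, connectorStep N m k

lemma invPochhammer_succ (n : ℕ) :
    invPochhammer (n + 1) = invPochhammer n * Ring.inverse (1 - (X : PowerSeries ℚ) ^ (n + 1)) :=
  prod_range_succ _ _

lemma invPochhammer_succ_mul (n : ℕ) :
    invPochhammer (n + 1) * (1 - X ^ (n + 1)) = invPochhammer n := by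
  rw [invPochhammer_succ, mul_assoc, mul_comm (Ring.inverse _),
    one_sub_X_pow_mul_inverse n.succ_pos, mul_one]

lemma tailPochhammer_eq_mul {N m : ℕ} (h : m < N) :
    tailPochhammer N m = (1 - X ^ m) * tailPochhammer N (m + 1) :=
  prod_eq_prod_Ico_succ_bot h _

lemma inverse_mul_tailPochhammer {N m : ℕ} (hm : 0 < m) (h : m < N) :
    Ring.inverse (1 - X ^ m) * tailPochhammer N m = tailPochhammer N (m + 1) := by
  rw [tailPochhammer_eq_mul h]
  linear_combination tailPochhammer N (m + 1) * one_sub_X_pow_mul_inverse hm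

lemma tailPochhammer_succ_eq {N m : ℕ} (h : m < N) :
    tailPochhammer N (m + 1) = tailPochhammer N 1 * invPochhammer m := by
  induction m with
  | zero => simp [invPochhammer]
  | succ m ih =>
    rw [← inverse_mul_tailPochhammer m.succ_pos h, ih (by omega), invPochhammer_succ]
    ring

lemma connector_zero_right (N m : ℕ) : connector N m 0 = 1 := by simp [connector]

lemma connector_zero_left {N : ℕ} (hN : 0 < N) (n : ℕ) : connector N 0 n = 1 := by
  simp [connector, connectorStep, tailPochhammer_eq_mul hN]

lemma connector_sub_succ_right (N m n : ℕ) :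
    connector N m n - connector N m (n + 1) = connectorStep N m n := by
  simp [connector, sum_range_succ]

lemma connector_sub_succ_left {N m : ℕ} (h : m < N) (n : ℕ) :
    connector N m (n + 1) - connector N (m + 1) (n + 1) =
      tailPochhammer N (m + 1) * X ^ (m * (n + 1)) * invPochhammer n := by
  induction n with
  | zero =>
    simp [connector, connectorStep, invPochhammer, tailPochhammer_eq_mul h]
    ring
  | succ n ih =>
    have h1 := connector_sub_succ_right N m (n + 1)
    have h2 := connector_sub_succ_right N (m + 1) (n + 1)
    rw [connectorStep, tailPochhammer_eq_mul h] at h1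
    rw [connectorStep] at h2
    rw [← invPochhammer_succ_mul] at ih
    linear_combination ih - h1 + h2

lemma connector_comm {N m n : ℕ} (hm : m ≤ N) (hn : n ≤ N) :
    connector N m n = connector N n m := by
  rcases Nat.eq_zero_or_pos N with rfl | hN
  · obtain rfl : m = 0 := by omega
    obtain rfl : n = 0 := by omega
    rfl
  induction n with
  | zero => rw [connector_zero_right, connector_zero_left hN]
  | succ n ih =>
    rcases m with _ | m
    · rw [connector_zero_right, connector_zero_left hN]
    · have h1 := connector_sub_succ_right N (m + 1) n
      have h2 := connector_sub_succ_left (show n < N by omega) m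
      rw [connectorStep, tailPochhammer_succ_eq (show m < N by omega)] at h1
      rw [tailPochhammer_succ_eq (show n < N by omega)] at h2
      linear_combination ih (by omega) - h1 + h2

lemma X_pow_dvd_connector_left (N : ℕ) {n : ℕ} (hn : 0 < n) :
    X ^ N ∣ connector N N n := by
  induction n, hn using Nat.le_induction with
  | base => simp [connector, connectorStep, tailPochhammer, invPochhammer]
  | succ n hn ih =>
    have h : connector N N (n + 1) = connector N N n - connectorStep N N n := by
      rw [← connector_sub_succ_right]; ring
    rw [h]
    refine dvd_sub ih (Dvd.dvd.mul_right (Dvd.dvd.mul_left (pow_dvd_pow _ ?_) _) _)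
    exact Nat.le_mul_of_pos_right _ hn

lemma X_pow_dvd_connector_right {N m : ℕ} (hm : 0 < m) (h : m ≤ N) :
    X ^ N ∣ connector N m N := by
  rw [connector_comm h le_rfl]
  exact X_pow_dvd_connector_left N hm

lemma connector_sub_left_eq {N k : ℕ} (hk : 0 < k) (h : k < N) (n : ℕ) :
    connector N k (n + 1) - connector N (k + 1) (n + 1) =
      X ^ k * Ring.inverse (1 - X ^ k) * (connector N k n - connector N k (n + 1)) := by
  rw [connector_sub_succ_left h, connector_sub_succ_right, connectorStep,
    ← inverse_mul_tailPochhammer hk h]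
  ring

lemma one_add_X_pow_mul_inverse {n : ℕ} (hn : 0 < n) :
    1 + X ^ n * Ring.inverse (1 - (X : PowerSeries ℚ) ^ n) =
      Ring.inverse (1 - (X : PowerSeries ℚ) ^ n) := by
  linear_combination - one_sub_X_pow_mul_inverse hn

lemma inverse_mul_connector_sub {N k m : ℕ} (hk : 0 < k) (h : k < N) (hm : 0 < m) :
    Ring.inverse (1 - X ^ m) * (connector N k m - connector N (k + 1) m) =
      Ring.inverse (1 - X ^ k) * (connector N k m - connector N k (m + 1)) := by
  obtain ⟨m, rfl⟩ := Nat.exists_eq_succ_of_ne_zero hm.ne'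
  rw [Nat.succ_eq_add_one, connector_sub_succ_left h, connector_sub_succ_right, connectorStep,
    ← inverse_mul_tailPochhammer hk h, invPochhammer_succ]
  ring

lemma X_pow_dvd_transport_lower {N k n : ℕ} (hk : 0 < k) (hkN : k ≤ N) (hn : n < N) :
    (X : PowerSeries ℚ) ^ N ∣
      ∑ m ∈ Ico k N, X ^ m * Ring.inverse (1 - X ^ m) * connector N m n -
        ∑ m ∈ Ico (n + 1) N, connector N k m := by
  induction hkN using Nat.decreasingInduction with
  | self =>
    rw [Ico_self, sum_empty, zero_sub, dvd_neg]
    refine dvd_sum fun m hm => X_pow_dvd_connector_left N ?_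
    have := mem_Ico.1 hm
    omega
  | of_succ k hkN ih =>
    have hsum : ∑ m ∈ Ico (n + 1) N, (connector N k m - connector N (k + 1) m) =
        X ^ k * Ring.inverse (1 - X ^ k) * (connector N k n - connector N k (N - 1)) := by
      obtain ⟨K, rfl⟩ : ∃ K, N = K + 1 := ⟨N - 1, by omega⟩
      rw [← sum_Ico_add' _ n K 1, ← neg_sub (connector _ k (K + 1 - 1)),
        Nat.add_sub_cancel, ← sum_Ico_sub (connector (K + 1) k) (show n ≤ K by omega),
        ← sum_neg_distrib, mul_sum]
      refine sum_congr rfl fun m _ => ?_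
      rw [connector_sub_left_eq hk hkN]
      ring
    have hlast : X ^ N ∣ X ^ k * Ring.inverse (1 - X ^ k) * connector N k (N - 1) := by
      have h1 := connector_sub_succ_right N k (N - 1)
      rw [Nat.sub_add_cancel (show 1 ≤ N by omega), sub_eq_iff_eq_add] at h1
      rw [h1, mul_add]
      refine dvd_add ?_ (Dvd.dvd.mul_left (X_pow_dvd_connector_right hk hkN.le) _)
      have h2 : X ^ k * Ring.inverse (1 - X ^ k) * connectorStep N k (N - 1) =
          X ^ (k + k * (N - 1)) * (Ring.inverse (1 - X ^ k) *
            (tailPochhammer N k * invPochhammer (N - 1))) := by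
        rw [connectorStep]; ring
      rw [h2]
      refine Dvd.dvd.mul_right (pow_dvd_pow _ ?_) _
      have := Nat.le_mul_of_pos_left (N - 1) hk
      omega
    rw [sum_sub_distrib] at hsum
    rw [sum_eq_sum_Ico_succ_bot hkN]
    convert dvd_add (ih (by omega)) hlast using 1
    linear_combination - hsum

lemma X_pow_dvd_transport_upper {N k n : ℕ} (hn : 0 < n) (hnN : n ≤ N) (hk : k < N) :
    (X : PowerSeries ℚ) ^ N ∣
      ∑ m ∈ Ico (k + 1) N, connector N m n -
        ∑ m ∈ Ico n N, X ^ m * Ring.inverse (1 - X ^ m) * connector N k m := by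
  have h := X_pow_dvd_transport_lower hn hnN hk
  rw [dvd_sub_comm] at h
  convert h using 2
  · refine sum_congr rfl fun m hm => connector_comm (mem_Ico.1 hm).2.le hnN
  · refine sum_congr rfl fun m hm => ?_
    rw [connector_comm (mem_Ico.1 hm).2.le hk.le]

lemma X_pow_dvd_transport_mixed {N k n : ℕ} (hk : 0 < k) (hkN : k ≤ N) (hn : 0 < n)
    (hnN : n ≤ N) :
    (X : PowerSeries ℚ) ^ N ∣
      ∑ m ∈ Ico k N, (1 + X ^ m * Ring.inverse (1 - X ^ m)) * connector N m n -
        ∑ m ∈ Ico n N, (1 + X ^ m * Ring.inverse (1 - X ^ m)) * connector N k m := by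
  induction hkN using Nat.decreasingInduction with
  | self =>
    rw [Ico_self, sum_empty, zero_sub, dvd_neg]
    refine dvd_sum fun m hm => Dvd.dvd.mul_left (X_pow_dvd_connector_left N ?_) _
    exact hn.trans_le (mem_Ico.1 hm).1
  | of_succ k hkN ih =>
    have hsum : ∑ m ∈ Ico n N, (1 + X ^ m * Ring.inverse (1 - X ^ m)) *
          (connector N k m - connector N (k + 1) m) =
        (1 + X ^ k * Ring.inverse (1 - X ^ k)) * (connector N k n - connector N k N) := by
      rw [← neg_sub (connector N k N), ← sum_Ico_sub (connector N k) hnN,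
        ← sum_neg_distrib, mul_sum]
      refine sum_congr rfl fun m hm => ?_
      have hm0 : 0 < m := hn.trans_le (mem_Ico.1 hm).1
      rw [one_add_X_pow_mul_inverse hk, one_add_X_pow_mul_inverse hm0,
        inverse_mul_connector_sub hk hkN hm0]
      ring
    simp_rw [mul_sub] at hsum
    rw [sum_sub_distrib] at hsum
    rw [sum_eq_sum_Ico_succ_bot hkN]
    convert dvd_add (ih (by omega)) (Dvd.dvd.mul_left (X_pow_dvd_connector_right hk hkN.le)
      (1 + X ^ k * Ring.inverse (1 - X ^ k))) using 1
    linear_combination - hsum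

/-- The weight of all chains for the word `w` whose largest shifted exponent is `n`. -/
noncomputable def wordWeight : List Letter → ℕ → PowerSeries ℚ
  | [], n => if n = 0 then 1 else 0
  | l :: w, n => lfactor l n * ∑ k ∈ range (n + 1 - l.isUpper.toNat), wordWeight w k

lemma dsh_cons_zero (l : Letter) (w : List Letter) :
    dsh (l :: w) 0 = dsh w 0 + l.isUpper.toNat := by
  cases h : l.isUpper <;> simp [dsh, h]

lemma dsh_cons_succ (l : Letter) (w : List Letter) (j : ℕ) : dsh (l :: w) (j + 1) = dsh w j := by
  simp [dsh]

lemma wordWeight_eq_zero (w : List Letter) {n : ℕ} (h : n < dsh w 0) : wordWeight w n = 0 := by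
  induction w generalizing n with
  | nil => simp [dsh] at h
  | cons l w ih =>
    rw [dsh_cons_zero] at h
    rw [wordWeight, sum_eq_zero, mul_zero]
    intro k hk
    rw [mem_range] at hk
    exact ih (by omega)

/-- The connected sum of two words, truncated at `N`. -/
noncomputable def connectedSum (N : ℕ) (u v : List Letter) : PowerSeries ℚ :=
  ∑ m ∈ range N, ∑ n ∈ range N, wordWeight u m * wordWeight v n * connector N m n

lemma connectedSum_comm (N : ℕ) (u v : List Letter) :
    connectedSum N u v = connectedSum N v u := by
  rw [connectedSum, sum_comm]
  refine sum_congr rfl fun m hm => sum_congr rfl fun n hn => ?_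
  rw [connector_comm (mem_range.1 hn).le (mem_range.1 hm).le]
  ring

lemma connectedSum_nil_right {N : ℕ} (hN : 0 < N) (u : List Letter) :
    connectedSum N u [] = ∑ m ∈ range N, wordWeight u m := by
  refine sum_congr rfl fun m _ => ?_
  rw [sum_eq_single_of_mem 0 (mem_range.2 hN) fun n _ hn => by simp [wordWeight, hn]]
  simp [wordWeight, connector_zero_right]

lemma connectedSum_cons_left (N : ℕ) (l : Letter) (u v : List Letter) :
    connectedSum N (l :: u) v = ∑ k ∈ range N, ∑ n ∈ range N, wordWeight u k * wordWeight v n *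
      ∑ m ∈ Ico (k + l.isUpper.toNat) N, lfactor l m * connector N m n := by
  have h1 : connectedSum N (l :: u) v = ∑ m ∈ range N,
      ∑ k ∈ range (m + 1 - l.isUpper.toNat), ∑ n ∈ range N,
        wordWeight u k * wordWeight v n * (lfactor l m * connector N m n) := by
    refine sum_congr rfl fun m _ => ?_
    rw [sum_comm]
    refine sum_congr rfl fun n _ => ?_
    rw [wordWeight, mul_sum, sum_mul, sum_mul]
    exact sum_congr rfl fun k _ => by ring
  rw [h1, sum_comm' (t' := range N) (s' := fun k => Ico (k + l.isUpper.toNat) N)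
    (fun m k => by simp only [mem_range, mem_Ico]; omega)]
  refine sum_congr rfl fun k _ => ?_
  rw [sum_comm]
  simp_rw [mul_sum]

lemma connectedSum_cons_right (N : ℕ) (l : Letter) (u v : List Letter) :
    connectedSum N u (l :: v) = ∑ k ∈ range N, ∑ n ∈ range N, wordWeight u k * wordWeight v n *
      ∑ m ∈ Ico (n + l.isUpper.toNat) N, lfactor l m * connector N k m := by
  rw [connectedSum_comm, connectedSum_cons_left, sum_comm]
  refine sum_congr rfl fun k hk => sum_congr rfl fun n _ => ?_
  rw [mul_comm (wordWeight v n)]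
  congr 1
  refine sum_congr rfl fun m hm => ?_
  rw [connector_comm (mem_Ico.1 hm).2.le (mem_range.1 hk).le]

lemma X_pow_dvd_kernel_sub (l : Letter) {N k n : ℕ} (hk : k < N) (hn : n < N)
    (hk0 : l.dual.isUpper = true → l.isUpper = false → 0 < k)
    (hn0 : l.isUpper = true → l.dual.isUpper = false → 0 < n)
    (hkn : l = .AD → 0 < k ∧ 0 < n) :
    (X : PowerSeries ℚ) ^ N ∣
      ∑ m ∈ Ico (k + l.isUpper.toNat) N, lfactor l m * connector N m n -
        ∑ m ∈ Ico (n + l.dual.isUpper.toNat) N, lfactor l.dual m * connector N k m := by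
  cases l <;> simp only [Letter.isUpper, Letter.dual, lfactor, one_mul, zero_mul, sum_const_zero,
    sub_self, dvd_zero, Bool.toNat_true, Bool.toNat_false, add_zero, forall_const,
    reduceCtorEq] at *
  · exact X_pow_dvd_transport_upper hn0 hn.le hk
  · exact X_pow_dvd_transport_upper hn0 hn.le hk
  · exact X_pow_dvd_transport_mixed hkn.1 hk.le hkn.2 hn.le
  · exact X_pow_dvd_transport_lower hk0 hk.le hn
  · exact X_pow_dvd_transport_lower hk0 hk.le hn

lemma X_pow_dvd_connectedSum_sub (N : ℕ) (l : Letter) (u v : List Letter)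
    (hu : l.isUpper = false → 0 < dsh u 0)
    (hv : l ≠ .BC → l.dual.isUpper = false → 0 < dsh v 0) :
    (X : PowerSeries ℚ) ^ N ∣ connectedSum N (l :: u) v - connectedSum N u (l.dual :: v) := by
  rw [connectedSum_cons_left, connectedSum_cons_right, ← sum_sub_distrib]
  refine dvd_sum fun k hk => ?_
  rw [← sum_sub_distrib]
  refine dvd_sum fun n hn => ?_
  rw [← mul_sub]
  by_cases huk : wordWeight u k = 0
  · simp [huk]
  by_cases hvn : wordWeight v n = 0
  · simp [hvn]
  have hk0 : dsh u 0 ≤ k := not_lt.1 fun h => huk (wordWeight_eq_zero u h)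
  have hn0 : dsh v 0 ≤ n := not_lt.1 fun h => hvn (wordWeight_eq_zero v h)
  refine Dvd.dvd.mul_left (X_pow_dvd_kernel_sub l (mem_range.1 hk) (mem_range.1 hn) ?_ ?_ ?_) _
  · exact fun _ h => (hu h).trans_le hk0
  · exact fun h h2 => (hv (by rintro rfl; simp [Letter.dual, Letter.isUpper] at h2) h2).trans_le hn0
  · rintro rfl
    exact ⟨(hu rfl).trans_le hk0, (hv (by simp) rfl).trans_le hn0⟩

lemma tauWord_cons_append (l : Letter) (u v : List Letter) :
    tauWord (l :: u) ++ v = tauWord u ++ l.dual :: v := by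
  simp [tauWord]

lemma dsh_zero_pos_of_getLast {u : List Letter} (hne : u ≠ [])
    (hu : ∀ x ∈ u.getLast?, x.isUpper = true) : 0 < dsh u 0 := by
  rw [dsh, List.drop_zero, List.countP_pos_iff]
  exact ⟨u.getLast hne, List.getLast_mem hne, hu _ (List.getLast?_eq_getLast_of_ne_nil hne)⟩

lemma dsh_zero_pos_of_cons {l : Letter} {u : List Letter}
    (h : ∀ x ∈ (l :: u).getLast?, x.isUpper = true) (hl : l.isUpper = false) : 0 < dsh u 0 := by
  rcases eq_or_ne u [] with rfl | hu
  · have := h l (by simp)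
    simp [hl] at this
  · refine dsh_zero_pos_of_getLast hu fun x hx => h x ?_
    rwa [List.getLast?_cons_of_ne_nil hu]

lemma X_pow_dvd_connectedSum_sub_tauWord (N : ℕ) (u v : List Letter)
    (hu : ∀ x ∈ u.getLast?, x.isUpper = true) (hv : 0 < dsh v 0) :
    (X : PowerSeries ℚ) ^ N ∣ connectedSum N u v - connectedSum N [] (tauWord u ++ v) := by
  induction u generalizing v with
  | nil => simp [tauWord]
  | cons l u ih =>
    rw [tauWord_cons_append, ← sub_add_sub_cancel _ (connectedSum N u (l.dual :: v))]
    refine dvd_add (X_pow_dvd_connectedSum_sub N l u v (dsh_zero_pos_of_cons hu) fun _ _ => hv)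
      (ih _ (fun x hx => hu x ?_) ?_)
    · rcases eq_or_ne u [] with rfl | hne
      · simp at hx
      · rwa [List.getLast?_cons_of_ne_nil hne]
    · rw [dsh_cons_zero]
      omega

/-- Antitone chains of length `k` bounded by `K`. -/
noncomputable def boundedChains (k K : ℕ) : Finset (Fin k → ℕ) :=
  open Classical in {m ∈ Fintype.piFinset fun _ => range (K + 1) | Antitone m}

lemma mem_boundedChains {k K : ℕ} {m : Fin k → ℕ} :
    m ∈ boundedChains k K ↔ (∀ i, m i ≤ K) ∧ Antitone m := by
  simp [boundedChains, Fintype.mem_piFinset]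

lemma sum_boundedChains_succ {M : Type*} [AddCommMonoid M] (k K : ℕ)
    (F : (Fin (k + 1) → ℕ) → M) :
    ∑ m ∈ boundedChains (k + 1) K, F m =
      ∑ a ∈ range (K + 1), ∑ m ∈ boundedChains k a, F (Fin.cons a m) := by
  rw [sum_sigma']
  refine sum_bij' (fun m _ => ⟨m 0, Fin.tail m⟩) (fun p _ => Fin.cons p.1 p.2) ?_ ?_ ?_ ?_ ?_
  · intro m hm
    rw [mem_boundedChains] at hm
    simp only [mem_sigma, mem_range, mem_boundedChains]
    exact ⟨Nat.lt_succ_of_le (hm.1 0), fun i => hm.2 (Fin.zero_le _),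
      fun i j hij => hm.2 (Fin.succ_le_succ_iff.2 hij)⟩
  · rintro ⟨a, m⟩ h
    simp only [mem_sigma, mem_range, mem_boundedChains] at h
    rw [mem_boundedChains]
    refine ⟨fun i => ?_, fun i j hij => ?_⟩
    · cases i using Fin.cases with
      | zero => simpa using Nat.le_of_lt_succ h.1
      | succ i => simpa using (h.2.1 i).trans (Nat.le_of_lt_succ h.1)
    · cases j using Fin.cases with
      | zero => rw [Fin.le_zero_iff.1 hij]
      | succ j =>
        cases i using Fin.cases with
        | zero => simpa using h.2.1 j
        | succ i => simpa using h.2.2 (Fin.succ_le_succ_iff.1 hij)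
  · intro m _
    exact Fin.cons_self_tail m
  · rintro ⟨a, m⟩ _
    simp
  · intro m _
    rw [Fin.cons_self_tail]

lemma sum_boundedChains_prod_lfactor (w : List Letter) (K : ℕ) :
    ∑ m ∈ boundedChains w.length K,
        ∏ j : Fin w.length, lfactor (w.get j) (m j + dsh w (j : ℕ)) =
      ∑ n ∈ range (dsh w 0 + (K + 1)), wordWeight w n := by
  induction w generalizing K with
  | nil =>
    have h : boundedChains 0 K = {Fin.elim0} := by
      ext m
      simp [mem_boundedChains, Subsingleton.elim m Fin.elim0, Subsingleton.antitone]
    simp [h, dsh, wordWeight]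
  | cons l w ih =>
    refine (sum_boundedChains_succ w.length K _).trans ?_
    rw [sum_range_add (wordWeight (l :: w)),
      sum_eq_zero fun n hn => wordWeight_eq_zero _ (mem_range.1 hn), zero_add]
    refine sum_congr rfl fun a _ => ?_
    rw [wordWeight, show dsh (l :: w) 0 + a + 1 - l.isUpper.toNat = dsh w 0 + (a + 1) by
      rw [dsh_cons_zero]; omega, ← ih, mul_sum]
    refine sum_congr rfl fun m _ => ?_
    refine (Fin.prod_univ_succ _).trans ?_
    simp [dsh_cons_succ, add_comm]

lemma coeff_fword (l : Letter) (w : List Letter) (hl : ∀ e, (X : PowerSeries ℚ) ^ e ∣ lfactor l e)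
    (d : ℕ) :
    coeff d (fword (l :: w)) = coeff d (∑ n ∈ range (d + 1), wordWeight (l :: w) n) := by
  have hterm (d : ℕ) (m : {m : Fin (l :: w).length → ℕ // Antitone m})
      (hm : m ∉ (boundedChains (l :: w).length d).subtype Antitone) :
      coeff d (∏ j : Fin (l :: w).length,
        lfactor ((l :: w).get j) (m.1 j + dsh (l :: w) (j : ℕ))) = 0 := by
    rw [mem_subtype, mem_boundedChains, not_and_or] at hm
    have h0 : d < m.1 0 := by
      obtain ⟨i, hi⟩ := not_forall.1 (hm.resolve_right (not_not.2 m.2))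
      exact (not_le.1 hi).trans_le (m.2 (Fin.zero_le _))
    have hdvd : (X : PowerSeries ℚ) ^ (m.1 0 + dsh (l :: w) 0) ∣ ∏ j : Fin (l :: w).length,
        lfactor ((l :: w).get j) (m.1 j + dsh (l :: w) (j : ℕ)) :=
      (hl _).trans (dvd_prod_of_mem _ (mem_univ (0 : Fin (l :: w).length)))
    exact X_pow_dvd_iff.1 hdvd d (by omega)
  have hsum : HasSum (fun m : {m : Fin (l :: w).length → ℕ // Antitone m} =>
      ∏ j : Fin (l :: w).length, lfactor ((l :: w).get j) (m.1 j + dsh (l :: w) (j : ℕ)))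
      (PowerSeries.mk fun d => ∑ m ∈ (boundedChains (l :: w).length d).subtype Antitone,
        coeff d (∏ j : Fin (l :: w).length,
          lfactor ((l :: w).get j) (m.1 j + dsh (l :: w) (j : ℕ)))) := by
    refine (PowerSeries.WithPiTopology.hasSum_iff_hasSum_coeff (R := ℚ)).2 fun d => ?_
    rw [coeff_mk]
    exact hasSum_sum_of_ne_finset_zero (hterm d)
  rw [fword, hsum.tsum_eq, coeff_mk, ← map_sum,
    sum_subtype_of_mem (fun m => ∏ j : Fin (l :: w).length,
      lfactor ((l :: w).get j) (m j + dsh (l :: w) (j : ℕ)))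
      (fun m hm => (mem_boundedChains.1 hm).2),
    sum_boundedChains_prod_lfactor, add_comm, sum_range_add, map_add, add_eq_left, map_sum]
  refine sum_eq_zero fun n _ => X_pow_dvd_iff.1 (Dvd.dvd.mul_right (hl _) _) d (by omega)

lemma X_pow_dvd_lfactor {l : Letter} (hl : l ∉ [Letter.AB, Letter.AC, Letter.AD]) (e : ℕ) :
    (X : PowerSeries ℚ) ^ e ∣ lfactor l e := by
  cases l <;> simp [lfactor] at hl ⊢

lemma isUpper_dual_of_notMem {l : Letter} (hl : l ∉ [Letter.AB, Letter.AC, Letter.AD]) :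
    l.dual.isUpper = true := by
  cases l <;> simp [Letter.dual, Letter.isUpper] at hl ⊢

lemma isUpper_of_notMem {l : Letter} (hl : l ∉ [Letter.AD, Letter.BD, Letter.CD]) :
    l.isUpper = true := by
  cases l <;> simp [Letter.isUpper] at hl ⊢

lemma dual_notMem {l : Letter} (hl : l ∉ [Letter.AD, Letter.BD, Letter.CD]) :
    l.dual ∉ [Letter.AB, Letter.AC, Letter.AD] := by
  cases l <;> simp [Letter.dual] at hl ⊢

/-- **Theorem 4.7 of the paper** (duality at `A = 0`, `B = C = ∞`, `D = 1`):
`f(w) = f(τ(w))` for every admissible word `w`. -/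
theorem fword_duality (w : List Letter) (hadm : AdmissibleWord w) :
    fword w = fword (tauWord w) := by
  rcases w with _ | ⟨l, u⟩
  · rfl
  have hl : l ∉ [Letter.AB, Letter.AC, Letter.AD] := hadm.1 l (by simp)
  have hlast : ∀ x ∈ (l :: u).getLast?, x.isUpper = true :=
    fun x hx => isUpper_of_notMem (hadm.2 x hx)
  obtain ⟨r, t, htau⟩ : ∃ r t, tauWord (l :: u) = r :: t :=
    List.exists_cons_of_ne_nil (by simp [tauWord])
  have hr : r ∉ [Letter.AB, Letter.AC, Letter.AD] := by
    have h : r ∈ (tauWord (l :: u)).head? := by simp [htau]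
    rw [tauWord, List.head?_reverse, List.getLast?_map, Option.mem_map] at h
    obtain ⟨x, hx, rfl⟩ := h
    exact dual_notMem (hadm.2 x hx)
  ext d
  rw [htau, coeff_fword l u (X_pow_dvd_lfactor hl), coeff_fword r t (X_pow_dvd_lfactor hr),
    ← sub_eq_zero, ← map_sub, ← htau, ← connectedSum_nil_right d.succ_pos,
    ← connectedSum_nil_right d.succ_pos, connectedSum_comm _ (tauWord _)]
  refine X_pow_dvd_iff.1 ?_ d d.lt_succ_self
  rw [← sub_add_sub_cancel _ (connectedSum (d + 1) u [l.dual])]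
  refine dvd_add (X_pow_dvd_connectedSum_sub _ l u [] (dsh_zero_pos_of_cons hlast) ?_) ?_
  · simp [isUpper_dual_of_notMem hl]
  · rw [← List.append_nil (tauWord (l :: u)), tauWord_cons_append]
    refine X_pow_dvd_connectedSum_sub_tauWord _ u _ (fun x hx => hlast x ?_) ?_
    · rcases eq_or_ne u [] with rfl | hne
      · simp at hx
      · rwa [List.getLast?_cons_of_ne_nil hne]
    · simp [dsh, isUpper_dual_of_notMem hl]
end

section
/- Case A=D of the main conjecture: Let A, B, C be independent indeterminates and q an indeterminate (so D = A, N = 0). For a word w = u_1⋯u_k in the letters {e_{AB},e_{AC},e_{AD},e_{BC},e_{BD},e_{CD}}, with exponents a_j, b_j, c_j, d_j defined by a_j = #{h ≤ j : u_h ∈ {BC,BD,CD}}, b_j = #{h ≤ j : u_h ∉ {AC,AD}} + #{h > j : u_h = CD}, c_j = #{h ≤ j : u_h ∉ {AB,AD}} + #{h > j : u_h = BD}, d_j = −#{h > j : u_h ∈ {AB,AC,BC}}, set L_q(w) := ∏_{j=1}^k ω_j where ω_j is: (A/(A−Aq^{a_j}) − A/(A−Bq^{b_j})) if u_j = e_{AB};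 (A/(A−Aq^{a_j}) − A/(A−Cq^{c_j})) if u_j = e_{AC}; (A/(A−Aq^{a_j}) − A/(A−Aq^{d_j})) if u_j = e_{AD}; (A/(A−Bq^{b_j}) − A/(A−Cq^{c_j})) if u_j = e_{BC}; (A/(A−Bq^{b_j}) − A/(A−Aq^{d_j})) if u_j = e_{BD}; (A/(A−Cq^{c_j}) − A/(A−Aq^{d_j})) if u_j = e_{CD}. Let τ be the anti-automorphism with τ(e_{uv}) = e_{σ(v)σ(u)}, σ = (A D)(B C). Then L_q(w) = L_q(τ(w)) in ℚ(A,B,C,q), for any admissible word w. -/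
/-- The field `ℚ(A, B, C, q)` of rational functions in four independent
indeterminates. -/
abbrev K4 : Type := FractionRing (MvPolynomial (Fin 4) ℚ)

noncomputable def vA : K4 := algebraMap (MvPolynomial (Fin 4) ℚ) K4 (MvPolynomial.X 0)
noncomputable def vB : K4 := algebraMap (MvPolynomial (Fin 4) ℚ) K4 (MvPolynomial.X 1)
noncomputable def vC : K4 := algebraMap (MvPolynomial (Fin 4) ℚ) K4 (MvPolynomial.X 2)
noncomputable def vq : K4 := algebraMap (MvPolynomial (Fin 4) ℚ) K4 (MvPolynomial.X 3)

/-- `a_j = #{h ≤ j : u_h ∈ {BC,BD,CD}}` (`j` is 1-based). -/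
def aexp (w : List Letter) (j : ℕ) : ℕ :=
  (w.take j).countP (fun u => u == Letter.BC || u == Letter.BD || u == Letter.CD)

/-- `b_j = #{h ≤ j : u_h ∉ {AC,AD}} + #{h > j : u_h = CD}` (`j` is 1-based). -/
def bexp (w : List Letter) (j : ℕ) : ℕ :=
  (w.take j).countP (fun u => !(u == Letter.AC || u == Letter.AD))
    + (w.drop j).countP (fun u => u == Letter.CD)

/-- `c_j = #{h ≤ j : u_h ∉ {AB,AD}} + #{h > j : u_h = BD}` (`j` is 1-based). -/
def cexp (w : List Letter) (j : ℕ) : ℕ :=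
  (w.take j).countP (fun u => !(u == Letter.AB || u == Letter.AD))
    + (w.drop j).countP (fun u => u == Letter.BD)

/-- `d_j = −#{h > j : u_h ∈ {AB,AC,BC}}` (`j` is 1-based). -/
def dexp (w : List Letter) (j : ℕ) : ℤ :=
  -(((w.drop j).countP
      (fun u => u == Letter.AB || u == Letter.AC || u == Letter.BC) : ℕ) : ℤ)

/-- The factor `ω_j` of `L_q(w)` in the case `A = D` (`j : Fin w.length`, 0-based,
corresponding to the 1-based index `j+1`). -/
noncomputable def omegaF (w : List Letter) (j : Fin w.length) : K4 :=
  match w.get j with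
  | .AB => vA / (vA - vA * vq ^ (aexp w (j + 1)))
      - vA / (vA - vB * vq ^ (bexp w (j + 1)))
  | .AC => vA / (vA - vA * vq ^ (aexp w (j + 1)))
      - vA / (vA - vC * vq ^ (cexp w (j + 1)))
  | .AD => vA / (vA - vA * vq ^ (aexp w (j + 1)))
      - vA / (vA - vA * vq ^ (dexp w (j + 1)))
  | .BC => vA / (vA - vB * vq ^ (bexp w (j + 1)))
      - vA / (vA - vC * vq ^ (cexp w (j + 1)))
  | .BD => vA / (vA - vB * vq ^ (bexp w (j + 1)))
      - vA / (vA - vA * vq ^ (dexp w (j + 1)))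
  | .CD => vA / (vA - vC * vq ^ (cexp w (j + 1)))
      - vA / (vA - vA * vq ^ (dexp w (j + 1)))

/-- `L_q(w) = ∏_j ω_j` in the degenerate case `A = D` (the single chain
`t_1 = ⋯ = t_k = A`). -/
noncomputable def LqAD (w : List Letter) : K4 :=
  ∏ j : Fin w.length, omegaF w j

section TelescopingFactor

variable {K : Type*} [Field K]

/-- The product `∏_{l=1}^{n} (A - B q^l)`. -/
def qProd (A B q : K) (n : ℕ) : K := ∏ i ∈ Finset.range n, (A - B * q ^ (i + 1))

lemma qProd_succ (A B q : K) (n : ℕ) :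
    qProd A B q (n + 1) = qProd A B q n * (A - B * q ^ (n + 1)) :=
  Finset.prod_range_succ _ _

lemma qProd_ne_zero {A B q : K} (h : ∀ n : ℕ, A - B * q ^ n ≠ 0) (n : ℕ) :
    qProd A B q n ≠ 0 :=
  Finset.prod_ne_zero_iff.2 fun _ _ => h _

/-- The cross ratio of the products `qProd` at `m`, `m + a`, `m + e`, `m + a + e`. -/
def crossRatio (A B q : K) (a e m : ℕ) : K :=
  qProd A B q (m + a + e) * qProd A B q m / (qProd A B q (m + e) * qProd A B q (m + a))

lemma crossRatio_comm (A B q : K) (a e m : ℕ) :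
    crossRatio A B q a e m = crossRatio A B q e a m := by
  simp only [crossRatio, add_right_comm m a e, mul_comm (qProd A B q (m + e))]

lemma crossRatio_zero_left {A B q : K} (h : ∀ n : ℕ, A - B * q ^ n ≠ 0) (e m : ℕ) :
    crossRatio A B q 0 e m = 1 :=
  div_self (mul_ne_zero (qProd_ne_zero h _) (qProd_ne_zero h _))

lemma crossRatio_zero_right {A B q : K} (h : ∀ n : ℕ, A - B * q ^ n ≠ 0) (a m : ℕ) :
    crossRatio A B q a 0 m = 1 := by
  rw [crossRatio_comm, crossRatio_zero_left h]

lemma crossRatio_succ_right {A B q : K} (h : ∀ n : ℕ, A - B * q ^ n ≠ 0) (a e m : ℕ) :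
    crossRatio A B q a (e + 1) m =
      crossRatio A B q a e m * ((A - B * q ^ (m + a + e + 1)) / (A - B * q ^ (m + e + 1))) := by
  have h1 := h (m + e + 1)
  simp only [crossRatio, ← add_assoc, qProd_succ]
  field_simp

lemma crossRatio_succ_left {A B q : K} (h : ∀ n : ℕ, A - B * q ^ n ≠ 0) (a e m : ℕ) :
    crossRatio A B q (a + 1) e m =
      crossRatio A B q a e m * ((A - B * q ^ (m + a + e + 1)) / (A - B * q ^ (m + a + 1))) := by
  rw [crossRatio_comm, crossRatio_succ_right h, crossRatio_comm, add_right_comm m e a]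

lemma crossRatio_succ_right_shift {A B q : K} (h : ∀ n : ℕ, A - B * q ^ n ≠ 0) (a e m : ℕ) :
    crossRatio A B q a (e + 1) m =
      crossRatio A B q a e (m + 1) * ((A - B * q ^ (m + a + 1)) / (A - B * q ^ (m + 1))) := by
  have h1 := h (m + 1)
  have h2 := h (m + a + 1)
  have h3 := qProd_ne_zero h (m + a)
  have h4 := qProd_ne_zero h (m + e + 1)
  rw [crossRatio, crossRatio, show m + 1 + a + e = m + a + e + 1 by ring,
    show m + a + (e + 1) = m + a + e + 1 by ring, show m + (e + 1) = m + e + 1 by ring,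
    show m + 1 + e = m + e + 1 by ring, show m + 1 + a = m + a + 1 by ring,
    qProd_succ A B q m, qProd_succ A B q (m + a)]
  field_simp

/-- The telescoping quantity comparing the factors of `L_q(w)` and `L_q(τ(w))`. -/
def telescope (A B C q : K) (a e m n : ℕ) : K :=
  crossRatio A B q a e m * crossRatio A C q a e n / q ^ (a * e)

/-- The factor attached to a letter with exponents `a`, `b`, `c`, `d`. -/
def letterFactor (A B C q : K) (u : Letter) (a b c : ℕ) (d : ℤ) : K :=
  match u with
  | .AB => A / (A - A * q ^ a) - A / (A - B * q ^ b)
  | .AC => A / (A - A * q ^ a) - A / (A - C * q ^ c)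
  | .AD => A / (A - A * q ^ a) - A / (A - A * q ^ d)
  | .BC => A / (A - B * q ^ b) - A / (A - C * q ^ c)
  | .BD => A / (A - B * q ^ b) - A / (A - A * q ^ d)
  | .CD => A / (A - C * q ^ c) - A / (A - A * q ^ d)

/-- `letterFactor` in terms of the shifted exponents `m = b - a`, `n = c - a`, `e = -d`. -/
def stateFactor (A B C q : K) (u : Letter) (a e m n : ℕ) : K :=
  letterFactor A B C q u a (m + a) (n + a) (-(e : ℤ))

variable {A B C q : K}

lemma div_sub_mul_zpow_neg (hA : A ≠ 0) (hq : q ≠ 0) {a : ℕ} (ha : q ^ a ≠ 1) :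
    A / (A - A * q ^ (-(a : ℤ))) = - (q ^ a / (1 - q ^ a)) := by
  have hx : q ^ a ≠ 0 := pow_ne_zero _ hq
  have h1 : 1 - q ^ a ≠ 0 := sub_ne_zero.2 ha.symm
  have h2 : q ^ a - 1 ≠ 0 := sub_ne_zero.2 ha
  rw [zpow_neg, zpow_natCast, show A - A * (q ^ a)⁻¹ = A * (q ^ a - 1) / q ^ a by field_simp]
  field_simp
  ring

lemma div_sub_mul_pow (hA : A ≠ 0) (a : ℕ) :
    A / (A - A * q ^ a) = 1 / (1 - q ^ a) := by
  rw [show A - A * q ^ a = A * (1 - q ^ a) by ring, div_mul_eq_div_div, div_self hA]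

lemma stateFactor_mul_telescope_AB (hA : A ≠ 0) (hq : q ≠ 0)
    (hB : ∀ n : ℕ, A - B * q ^ n ≠ 0) (hC : ∀ n : ℕ, A - C * q ^ n ≠ 0)
    (a e m n : ℕ) (ha : q ^ a ≠ 1) :
    stateFactor A B C q .AB a e (m + 1) n * telescope A B C q a (e + 1) m n =
      stateFactor A B C q .CD (e + 1) a m n * telescope A B C q a e (m + 1) n := by
  have h1 : 1 - q ^ a ≠ 0 := sub_ne_zero.2 ha.symm
  have h2 := hB (m + 1 + a)
  have h3 := hC (n + (e + 1))
  have h4 := hB (m + 1)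
  simp only [stateFactor, letterFactor, telescope, crossRatio_succ_right_shift hB,
    crossRatio_succ_right hC, div_sub_mul_zpow_neg hA hq ha, div_sub_mul_pow hA, mul_add, mul_one]
  rw [show m + a + 1 = m + 1 + a by ring, show n + e + 1 = n + (e + 1) by ring]
  field_simp
  ring

lemma stateFactor_mul_telescope_AC (hA : A ≠ 0) (hq : q ≠ 0)
    (hB : ∀ n : ℕ, A - B * q ^ n ≠ 0) (hC : ∀ n : ℕ, A - C * q ^ n ≠ 0)
    (a e m n : ℕ) (ha : q ^ a ≠ 1) :
    stateFactor A B C q .AC a e m (n + 1) * telescope A B C q a (e + 1) m n =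
      stateFactor A B C q .BD (e + 1) a m n * telescope A B C q a e m (n + 1) := by
  have h1 : 1 - q ^ a ≠ 0 := sub_ne_zero.2 ha.symm
  have h2 := hC (n + 1 + a)
  have h3 := hB (m + (e + 1))
  have h4 := hC (n + 1)
  simp only [stateFactor, letterFactor, telescope, crossRatio_succ_right_shift hC,
    crossRatio_succ_right hB, div_sub_mul_zpow_neg hA hq ha, div_sub_mul_pow hA, mul_add, mul_one]
  rw [show n + a + 1 = n + 1 + a by ring, show m + e + 1 = m + (e + 1) by ring]
  field_simp
  ring

lemma stateFactor_AD (hA : A ≠ 0) (hq : q ≠ 0) (a e m n : ℕ)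
    (ha : q ^ a ≠ 1) (he : q ^ e ≠ 1) :
    stateFactor A B C q .AD a e m n = stateFactor A B C q .AD e a m n := by
  have h1 : 1 - q ^ a ≠ 0 := sub_ne_zero.2 ha.symm
  have h2 : 1 - q ^ e ≠ 0 := sub_ne_zero.2 he.symm
  simp only [stateFactor, letterFactor, div_sub_mul_zpow_neg hA hq ha,
    div_sub_mul_zpow_neg hA hq he, div_sub_mul_pow hA]
  field_simp
  ring

lemma stateFactor_mul_telescope_BC (hq : q ≠ 0)
    (hB : ∀ n : ℕ, A - B * q ^ n ≠ 0) (hC : ∀ n : ℕ, A - C * q ^ n ≠ 0)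
    (a e m n : ℕ) :
    stateFactor A B C q .BC (a + 1) e m n * telescope A B C q a (e + 1) m n =
      stateFactor A B C q .BC (e + 1) a m n * telescope A B C q (a + 1) e m n := by
  have h1 := hB (m + a + 1)
  have h2 := hB (m + e + 1)
  have h3 := hC (n + a + 1)
  have h4 := hC (n + e + 1)
  simp only [stateFactor, letterFactor, telescope, crossRatio_succ_left hB,
    crossRatio_succ_left hC, crossRatio_succ_right hB, crossRatio_succ_right hC, mul_add, add_mul,
    mul_one, one_mul, ← add_assoc]
  field_simp
  ring

lemma telescope_comm (a e m n : ℕ) :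
    telescope A B C q a e m n = telescope A B C q e a m n := by
  simp only [telescope, crossRatio_comm A B q a, crossRatio_comm A C q a, mul_comm a e]

lemma stateFactor_mul_telescope_BD (hA : A ≠ 0) (hq : q ≠ 0)
    (hB : ∀ n : ℕ, A - B * q ^ n ≠ 0) (hC : ∀ n : ℕ, A - C * q ^ n ≠ 0)
    (a e m n : ℕ) (he : q ^ e ≠ 1) :
    stateFactor A B C q .BD (a + 1) e m n * telescope A B C q a e m (n + 1) =
      stateFactor A B C q .AC e a m (n + 1) * telescope A B C q (a + 1) e m n := by
  rw [telescope_comm a, telescope_comm (a + 1), stateFactor_mul_telescope_AC hA hq hB hC e a m n he]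

lemma stateFactor_mul_telescope_CD (hA : A ≠ 0) (hq : q ≠ 0)
    (hB : ∀ n : ℕ, A - B * q ^ n ≠ 0) (hC : ∀ n : ℕ, A - C * q ^ n ≠ 0)
    (a e m n : ℕ) (he : q ^ e ≠ 1) :
    stateFactor A B C q .CD (a + 1) e m n * telescope A B C q a e (m + 1) n =
      stateFactor A B C q .AB e a (m + 1) n * telescope A B C q (a + 1) e m n := by
  rw [telescope_comm a, telescope_comm (a + 1), stateFactor_mul_telescope_AB hA hq hB hC e a m n he]

end TelescopingFactor

section Words

/-- Number of letters `e_{Bv}`, `e_{Cv}`. -/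
def countLow (l : List Letter) : ℕ :=
  l.countP (fun u => u == Letter.BC || u == Letter.BD || u == Letter.CD)

/-- Number of letters `e_{uB}`, `e_{uC}`. -/
def countHigh (l : List Letter) : ℕ :=
  l.countP (fun u => u == Letter.AB || u == Letter.AC || u == Letter.BC)

/-- The factor of `L_q(w)` at the (0-based) position `j`. -/
noncomputable def factorAt (w : List Letter) (j : ℕ) : K4 :=
  match w[j]? with
  | none => 1
  | some u => letterFactor vA vB vC vq u (aexp w (j + 1)) (bexp w (j + 1)) (cexp w (j + 1))
      (dexp w (j + 1))

lemma LqAD_eq_prod_range (w : List Letter) :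
    LqAD w = ∏ j ∈ Finset.range w.length, factorAt w j := by
  rw [LqAD, Finset.prod_range]
  refine Finset.prod_congr rfl fun j _ => ?_
  rw [factorAt, List.getElem?_eq_getElem j.2]
  rfl

lemma countP_eq_countLow_add_count_AB (l : List Letter) :
    l.countP (fun u => !(u == Letter.AC || u == Letter.AD)) =
      countLow l + l.count Letter.AB := by
  induction l with
  | nil => rfl
  | cons u l ih =>
    simp only [countLow, List.countP_cons, List.count_cons] at ih ⊢
    cases u <;> simp at ih ⊢ <;> lia

lemma countP_eq_countLow_add_count_AC (l : List Letter) :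
    l.countP (fun u => !(u == Letter.AB || u == Letter.AD)) =
      countLow l + l.count Letter.AC := by
  induction l with
  | nil => rfl
  | cons u l ih =>
    simp only [countLow, List.countP_cons, List.count_cons] at ih ⊢
    cases u <;> simp at ih ⊢ <;> lia

lemma factorAt_append_cons (P S : List Letter) (u : Letter) :
    factorAt (P ++ u :: S) P.length =
      stateFactor vA vB vC vq u (countLow (P ++ [u])) (countHigh S)
        ((P ++ [u]).count .AB + S.count .CD) ((P ++ [u]).count .AC + S.count .BD) := by
  have ht : (P ++ u :: S).take (P.length + 1) = P ++ [u] := by simp [List.take_append]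
  have hd : (P ++ u :: S).drop (P.length + 1) = S := by simp [List.drop_append]
  have hg : (P ++ u :: S)[P.length]? = some u := by simp
  rw [factorAt, hg, stateFactor, aexp, bexp, cexp, dexp, ht, hd,
    countP_eq_countLow_add_count_AB, countP_eq_countLow_add_count_AC]
  simp only [add_assoc, add_comm (countLow _)]
  rfl

lemma length_tauWord (l : List Letter) : (tauWord l).length = l.length := by
  simp [tauWord]

lemma tauWord_append_cons (P S : List Letter) (u : Letter) :
    tauWord (P ++ u :: S) = tauWord S ++ u.dual :: tauWord P := by
  simp [tauWord]

lemma countP_tauWord (p : Letter → Bool) (l : List Letter) :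
    (tauWord l).countP p = l.countP (fun u => p u.dual) := by
  simp only [tauWord, List.countP_reverse, List.countP_map]
  rfl

lemma countLow_tauWord (l : List Letter) : countLow (tauWord l) = countHigh l := by
  rw [countLow, countP_tauWord, countHigh]
  congr 1
  funext u
  cases u <;> rfl

lemma countHigh_tauWord (l : List Letter) : countHigh (tauWord l) = countLow l := by
  rw [countHigh, countP_tauWord, countLow]
  congr 1
  funext u
  cases u <;> rfl

lemma count_tauWord (v : Letter) (l : List Letter) :
    (tauWord l).count v = l.count v.dual := by
  rw [List.count, countP_tauWord, List.count]
  congr 1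
  funext u
  cases u <;> cases v <;> rfl

lemma tauWord_append_singleton (S : List Letter) (u : Letter) :
    tauWord S ++ [u.dual] = tauWord (u :: S) := by
  simp [tauWord]

lemma factorAt_tauWord (P S : List Letter) (u : Letter) :
    factorAt (tauWord (P ++ u :: S)) S.length =
      stateFactor vA vB vC vq u.dual (countHigh (u :: S)) (countLow P)
        (P.count .AB + (u :: S).count .CD) (P.count .AC + (u :: S).count .BD) := by
  rw [tauWord_append_cons, ← length_tauWord S, factorAt_append_cons, tauWord_append_singleton]
  simp only [countLow_tauWord, countHigh_tauWord, count_tauWord, Letter.dual]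
  rw [add_comm (P.count .AB), add_comm (P.count .AC)]

lemma vA_ne_zero : vA ≠ 0 := by
  simp [vA]

lemma vq_ne_zero : vq ≠ 0 := by
  simp [vq]

lemma vq_pow_ne_one {n : ℕ} (hn : n ≠ 0) : vq ^ n ≠ 1 := by
  rw [vq, ← map_pow, ← map_one (algebraMap (MvPolynomial (Fin 4) ℚ) K4)]
  intro h
  have h := IsFractionRing.injective (MvPolynomial (Fin 4) ℚ) K4 h
  simpa [hn] using congrArg (MvPolynomial.eval (0 : Fin 4 → ℚ)) h

lemma vA_sub_algebraMap_X_mul_pow_ne_zero {i : Fin 4} (hi : i ≠ 0) (n : ℕ) :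
    vA - algebraMap (MvPolynomial (Fin 4) ℚ) K4 (MvPolynomial.X i) * vq ^ n ≠ 0 := by
  rw [vA, vq, ← map_pow, ← map_mul, sub_ne_zero]
  intro h
  have h := IsFractionRing.injective (MvPolynomial (Fin 4) ℚ) K4 h
  simpa [hi] using congrArg (MvPolynomial.eval (Pi.single 0 1 : Fin 4 → ℚ)) h

lemma vA_sub_vB_mul_pow_ne_zero (n : ℕ) : vA - vB * vq ^ n ≠ 0 :=
  vA_sub_algebraMap_X_mul_pow_ne_zero (by decide) n

lemma vA_sub_vC_mul_pow_ne_zero (n : ℕ) : vA - vC * vq ^ n ≠ 0 :=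
  vA_sub_algebraMap_X_mul_pow_ne_zero (by decide) n

/-- The telescoping quantity of the word `P ++ S` split after `P`. -/
noncomputable def splitTelescope (P S : List Letter) : K4 :=
  telescope vA vB vC vq (countLow P) (countHigh S)
    (P.count .AB + S.count .CD) (P.count .AC + S.count .BD)

lemma countLow_ne_zero {P S : List Letter} {u : Letter} (h : AdmissibleWord (P ++ u :: S))
    (hu : u ∈ [Letter.AB, Letter.AC, Letter.AD]) : countLow P ≠ 0 := by
  cases P with
  | nil => exact absurd hu (h.1 u (by simp))
  | cons v P =>
    have hv := h.1 v (by simp)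
    cases v <;> simp [countLow] at hv ⊢

lemma countHigh_ne_zero {P S : List Letter} {u : Letter} (h : AdmissibleWord (P ++ u :: S))
    (hu : u ∈ [Letter.AD, Letter.BD, Letter.CD]) : countHigh S ≠ 0 := by
  rcases List.eq_nil_or_concat S with rfl | ⟨S, v, rfl⟩
  · exact absurd hu (h.2 u (by simp))
  · have hv := h.2 v (by simp [List.getLast?_append, List.getLast?_cons])
    cases v <;> simp [countHigh, List.countP_append] at hv ⊢

lemma factorAt_mul_splitTelescope {P S : List Letter} {u : Letter}
    (h : AdmissibleWord (P ++ u :: S)) :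
    factorAt (P ++ u :: S) P.length * splitTelescope P (u :: S) =
      factorAt (tauWord (P ++ u :: S)) S.length * splitTelescope (P ++ [u]) S := by
  have hlow := fun hu => vq_pow_ne_one (countLow_ne_zero h hu)
  have hhigh := fun hu => vq_pow_ne_one (countHigh_ne_zero h hu)
  rw [factorAt_append_cons, factorAt_tauWord, splitTelescope, splitTelescope]
  cases u
  · have := stateFactor_mul_telescope_AB vA_ne_zero vq_ne_zero vA_sub_vB_mul_pow_ne_zero
      vA_sub_vC_mul_pow_ne_zero (countLow P) (countHigh S) (P.count .AB + S.count .CD)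
      (P.count .AC + S.count .BD) (hlow (by simp))
    simpa [countLow, countHigh, Letter.dual, List.count_cons, add_right_comm] using this
  · have := stateFactor_mul_telescope_AC vA_ne_zero vq_ne_zero vA_sub_vB_mul_pow_ne_zero
      vA_sub_vC_mul_pow_ne_zero (countLow P) (countHigh S) (P.count .AB + S.count .CD)
      (P.count .AC + S.count .BD) (hlow (by simp))
    simpa [countLow, countHigh, Letter.dual, List.count_cons, add_right_comm] using this
  · have := stateFactor_AD (B := vB) (C := vC) vA_ne_zero vq_ne_zero (countLow P) (countHigh S)
      (P.count .AB + S.count .CD) (P.count .AC + S.count .BD) (hlow (by simp)) (hhigh (by simp))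
    simp only [countLow, countHigh] at this
    simp [countLow, countHigh, Letter.dual, this]
  · have := stateFactor_mul_telescope_BC vq_ne_zero vA_sub_vB_mul_pow_ne_zero
      vA_sub_vC_mul_pow_ne_zero (countLow P) (countHigh S) (P.count .AB + S.count .CD)
      (P.count .AC + S.count .BD)
    simpa [countLow, countHigh, Letter.dual, List.count_cons] using this
  · have := stateFactor_mul_telescope_BD vA_ne_zero vq_ne_zero vA_sub_vB_mul_pow_ne_zero
      vA_sub_vC_mul_pow_ne_zero (countLow P) (countHigh S) (P.count .AB + S.count .CD)
      (P.count .AC + S.count .BD) (hhigh (by simp))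
    simpa [countLow, countHigh, Letter.dual, List.count_cons, add_assoc] using this
  · have := stateFactor_mul_telescope_CD vA_ne_zero vq_ne_zero vA_sub_vB_mul_pow_ne_zero
      vA_sub_vC_mul_pow_ne_zero (countLow P) (countHigh S) (P.count .AB + S.count .CD)
      (P.count .AC + S.count .BD) (hhigh (by simp))
    simpa [countLow, countHigh, Letter.dual, List.count_cons, add_assoc] using this

lemma splitTelescope_nil_left (S : List Letter) : splitTelescope [] S = 1 := by
  simp [splitTelescope, telescope, countLow, crossRatio_zero_left vA_sub_vB_mul_pow_ne_zero,
    crossRatio_zero_left vA_sub_vC_mul_pow_ne_zero]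

lemma splitTelescope_nil_right (P : List Letter) : splitTelescope P [] = 1 := by
  simp [splitTelescope, telescope, countHigh, crossRatio_zero_right vA_sub_vB_mul_pow_ne_zero,
    crossRatio_zero_right vA_sub_vC_mul_pow_ne_zero]

lemma prod_factorAt_eq {w : List Letter} (h : AdmissibleWord w) {k : ℕ} (hk : k ≤ w.length) :
    ∏ j ∈ Finset.range k, factorAt w j =
      (∏ j ∈ Finset.range k, factorAt (tauWord w) (w.length - 1 - j)) *
        splitTelescope (w.take k) (w.drop k) := by
  induction k with
  | zero => simp [splitTelescope_nil_left]
  | succ k ih =>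
    have hw : w.take k ++ w[k] :: w.drop (k + 1) = w := by
      rw [← List.drop_eq_getElem_cons hk, List.take_append_drop]
    have key := factorAt_mul_splitTelescope (hw.symm ▸ h)
    rw [hw, ← List.drop_eq_getElem_cons hk, ← List.take_succ_eq_append_getElem hk,
      List.length_take_of_le (by omega), List.length_drop,
      show w.length - (k + 1) = w.length - 1 - k by omega] at key
    rw [Finset.prod_range_succ, Finset.prod_range_succ, ih (by omega)]
    linear_combination
      (∏ j ∈ Finset.range k, factorAt (tauWord w) (w.length - 1 - j)) * key

end Words

/-- **Theorem 4.8 of the paper** (the case `A = D` of the main conjecture):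
`L_q(w) = L_q(τ(w))` in `ℚ(A,B,C,q)` for every admissible word `w`. -/
theorem LqAD_duality (w : List Letter) (hadm : AdmissibleWord w) :
    LqAD w = LqAD (tauWord w) := by
  have h := prod_factorAt_eq hadm le_rfl
  rw [List.take_length, List.drop_length, splitTelescope_nil_right, mul_one,
    Finset.prod_range_reflect] at h
  rw [LqAD_eq_prod_range, LqAD_eq_prod_range, length_tauWord, h]
end
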